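/- arXiv:1507.06102 — 9 statements merged into one kernel-verified Lean document; each statement's English description precedes it below -/
import Mathlib

section
/- Let γ ≥ 0 and let G : ℝ → ℝ be integrable with M := ∫_ℝ (1+z²)^{γ/2} |G(z)| dz < ∞. Then for every continuous u : ℝ → ℝ with ‖u‖_{C⁰_γ} < ∞, the convolution (G * u)(x) = ∫_ℝ G(x−y) u(y) dy converges absolutely for every x ∈ ℝ, and ‖G * u‖_{C⁰_γ} ≤ 2^{γ/2} M ‖u‖_{C⁰_γ}. (This uses that (1+(x−z)²)/(1+x²) ≤ 2(1+z²) for all x, z ∈ ℝ.) -/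
open MeasureTheory Set

/-- Weighted convolution bound: if `G` is integrable with
`M = ∫ (1+z²)^{γ/2}|G(z)| dz < ∞`, then for every continuous `u` with finite `C⁰_γ`-norm
the convolution `G * u` converges absolutely at every point and
`‖G * u‖_{C⁰_γ} ≤ 2^{γ/2} M ‖u‖_{C⁰_γ}`. -/
theorem stmt_3 (γ : ℝ) (hγ : 0 ≤ γ) (G : ℝ → ℝ)
    (hGint : MeasureTheory.Integrable G)
    (hG : MeasureTheory.Integrable (fun z : ℝ => (1 + z ^ 2) ^ (γ / 2) * |G z|))
    (u : ℝ → ℝ) (hu : Continuous u)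
    (hbdd : BddAbove (Set.range fun x : ℝ => (1 + x ^ 2) ^ (-(γ / 2)) * |u x|)) :
    (∀ x : ℝ, MeasureTheory.Integrable (fun y : ℝ => G (x - y) * u y)) ∧
    ∀ x : ℝ, (1 + x ^ 2) ^ (-(γ / 2)) * |∫ y : ℝ, G (x - y) * u y| ≤
      (2 : ℝ) ^ (γ / 2) * (∫ z : ℝ, (1 + z ^ 2) ^ (γ / 2) * |G z|) *
        (⨆ x' : ℝ, (1 + x' ^ 2) ^ (-(γ / 2)) * |u x'|) := by
  set K := ⨆ x' : ℝ, (1 + x' ^ 2) ^ (-(γ / 2)) * |u x'| with hK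
  have hub : ∀ y : ℝ, |u y| ≤ K * (1 + y ^ 2) ^ (γ / 2) := by
    intro y
    have h1 : (1 + y ^ 2) ^ (-(γ / 2)) * |u y| ≤ K := le_ciSup hbdd y
    have hp : (0 : ℝ) < 1 + y ^ 2 := by positivity
    have hq : (0 : ℝ) < (1 + y ^ 2) ^ (γ / 2) := Real.rpow_pos_of_pos hp _
    rw [Real.rpow_neg hp.le, inv_mul_le_iff₀ hq] at h1
    linarith
  have hK0 : 0 ≤ K := Real.iSup_nonneg (fun y => by positivity)
  have hw : ∀ x y : ℝ, (1 + y ^ 2) ^ (γ / 2) ≤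
      2 ^ (γ / 2) * (1 + x ^ 2) ^ (γ / 2) * (1 + (x - y) ^ 2) ^ (γ / 2) := by
    intro x y
    rw [← Real.mul_rpow (by positivity) (by positivity),
      ← Real.mul_rpow (by positivity) (by positivity)]
    apply Real.rpow_le_rpow (by positivity) _ (by positivity)
    nlinarith [sq_nonneg (x + (x - y)), mul_nonneg (sq_nonneg x) (sq_nonneg (x - y))]
  have hpt : ∀ x y : ℝ, ‖G (x - y) * u y‖ ≤ (K * (2 ^ (γ / 2) * (1 + x ^ 2) ^ (γ / 2))) *
      ((1 + (x - y) ^ 2) ^ (γ / 2) * |G (x - y)|) := by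
    intro x y
    rw [Real.norm_eq_abs, abs_mul]
    calc |G (x - y)| * |u y| ≤ |G (x - y)| * (K * (2 ^ (γ / 2) * (1 + x ^ 2) ^ (γ / 2) *
          (1 + (x - y) ^ 2) ^ (γ / 2))) := by
          gcongr
          exact (hub y).trans (mul_le_mul_of_nonneg_left (hw x y) hK0)
      _ = _ := by ring
  have hdom : ∀ x : ℝ, Integrable (fun y : ℝ =>
      (K * (2 ^ (γ / 2) * (1 + x ^ 2) ^ (γ / 2))) *
      ((1 + (x - y) ^ 2) ^ (γ / 2) * |G (x - y)|)) := fun x =>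
    (hG.comp_sub_left x).const_mul _
  refine ⟨fun x => (hdom x).mono' ((hGint.comp_sub_left x).aestronglyMeasurable.mul
    hu.aestronglyMeasurable) (Filter.Eventually.of_forall (hpt x)), fun x => ?_⟩
  have h := norm_integral_le_of_norm_le (hdom x) (Filter.Eventually.of_forall (hpt x))
  rw [integral_const_mul,
    integral_sub_left_eq_self (fun z : ℝ => (1 + z ^ 2) ^ (γ / 2) * |G z|) volume x,
    Real.norm_eq_abs] at h
  have hp : (0 : ℝ) < 1 + x ^ 2 := by positivity
  have hq : (0 : ℝ) < (1 + x ^ 2) ^ (γ / 2) := Real.rpow_pos_of_pos hp _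
  rw [Real.rpow_neg hp.le, inv_mul_le_iff₀ hq]
  refine h.trans (le_of_eq ?_)
  ring
end

section
/- For every t > 0, the double integral ∫_0^t ∫_ℝ exp(−2 s (1 − k²)²) dk ds is finite. -/
open MeasureTheory Set

/-- The pointwise variance of the stochastic convolution is finite: for every `t > 0`,
`∫_0^t ∫_ℝ exp(−2s(1−k²)²) dk ds < ∞`. -/
theorem stmt_5 (t : ℝ) (ht : 0 < t) :
    (∫⁻ s in Set.Ioc (0 : ℝ) t,
        ∫⁻ k : ℝ, ENNReal.ofReal (Real.exp (-2 * s * (1 - k ^ 2) ^ 2))) < ⊤ := by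
  set C : ℝ := Real.exp (5 / 2 * t) * √(Real.pi / 2) with hC
  have hint : IntegrableOn (fun s : ℝ => C * s ^ (-(1 / 2) : ℝ)) (Ioc 0 t) := by
    have h := (intervalIntegral.intervalIntegrable_rpow' (a := 0) (b := t)
      (r := (-(1 / 2) : ℝ)) (by norm_num))
    rw [intervalIntegrable_iff_integrableOn_Ioc_of_le ht.le] at h
    exact h.const_mul C
  refine lt_of_le_of_lt ?_ hint.lintegral_lt_top
  refine setLIntegral_mono' measurableSet_Ioc ?_
  rintro s ⟨hs, hst⟩
  have hi : Integrable (fun k : ℝ => Real.exp (5 / 2 * t) * Real.exp (-(2 * s) * k ^ 2)) :=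
    (integrable_exp_neg_mul_sq (by positivity : 0 < 2 * s)).const_mul _
  calc _ ≤ ∫⁻ k : ℝ, ENNReal.ofReal (Real.exp (5 / 2 * t) * Real.exp (-(2 * s) * k ^ 2)) := by
        refine lintegral_mono fun k => ENNReal.ofReal_le_ofReal ?_
        rw [← Real.exp_add]
        apply Real.exp_le_exp.mpr
        nlinarith [mul_nonneg hs.le (sq_nonneg (k ^ 2 - 3 / 2))]
    _ = ENNReal.ofReal (C * s ^ (-(1 / 2) : ℝ)) := by
        rw [← ofReal_integral_eq_lintegral_ofReal hi
          (Filter.Eventually.of_forall fun k => by positivity)]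
        rw [integral_const_mul, integral_gaussian, hC, Real.rpow_neg hs.le, ← Real.sqrt_eq_rpow,
          mul_assoc, ← div_div, Real.sqrt_div (by positivity), div_eq_mul_inv (√(Real.pi / 2))]
    _ ≤ _ := le_rfl
end

section
/- For all T > 0 and all κ ∈ (0,1), there exist ε₀ > 0, γ₀ > 0, and C > 0 such that for all γ ∈ (0, γ₀), all ε ∈ (0, ε₀), and all ν ∈ ℝ with |ν| ≤ 1, ∫_0^T ∫_ℝ |f(τ,k)|² (|k|^{2γ} + 1) dk dτ ≤ C ε^{1−κ}, where f is the error kernel defined in the context. -/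
open MeasureTheory Set

/-- The error kernel `f(τ,k)`: the Fourier multiplier of the difference between the rescaled
Swift–Hohenberg semigroup and the limiting semigroup of the amplitude equation. -/
noncomputable def fker (ε ν τ k : ℝ) : ℝ :=
  if -1 / ε ≤ k then
    Real.exp (τ * ν) *
      (Real.exp (-τ * k ^ 2 * (2 + k * ε) ^ 2) - Real.exp (-4 * τ * k ^ 2))
  else
    -(Real.exp (τ * ν) * Real.exp (-4 * τ * k ^ 2))

lemma exp_diff_aux (a b c : ℝ) (ha : c ≤ a) (hb : c ≤ b) :
    |Real.exp (-a) - Real.exp (-b)| ≤ Real.exp (-c) * |a - b| := by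
  wlog h : a ≤ b generalizing a b
  · rw [abs_sub_comm, abs_sub_comm a b]
    exact this b a hb ha (le_of_not_ge h)
  have h1 : Real.exp (-b) ≤ Real.exp (-a) := Real.exp_le_exp.2 (by linarith)
  rw [abs_of_nonneg (by linarith), abs_of_nonpos (by linarith)]
  have h2 : Real.exp (-b) = Real.exp (-a) * Real.exp (a - b) := by
    rw [← Real.exp_add]; ring_nf
  have h3 := Real.add_one_le_exp (a - b)
  have h4 : Real.exp (-a) ≤ Real.exp (-c) := Real.exp_le_exp.2 (by linarith)
  have h5 := Real.exp_pos (-a)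
  calc Real.exp (-a) - Real.exp (-b) = Real.exp (-a) * (1 - Real.exp (a - b)) := by rw [h2]; ring
    _ ≤ Real.exp (-a) * (-(a - b)) := by gcongr; linarith
    _ ≤ _ := by gcongr; linarith

lemma core_bound (ε τ k : ℝ) (hε : 0 < ε) (hτ : 0 < τ) (hk : -1 / ε ≤ k) (hx : |k| * ε ≤ 1) :
    (Real.exp (-τ * k ^ 2 * (2 + k * ε) ^ 2) - Real.exp (-4 * τ * k ^ 2)) ^ 2 ≤
      50 * Real.exp (-(τ * k ^ 2)) * (|k| * ε) ^ 2 := by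
  have hx2 : |k * ε| ≤ 1 := by rwa [abs_mul, abs_of_pos hε]
  obtain ⟨hl, hu⟩ := abs_le.1 hx2
  have hy : 0 ≤ τ * k ^ 2 := by positivity
  have h := exp_diff_aux (τ * k ^ 2 * (2 + k * ε) ^ 2) (4 * (τ * k ^ 2)) (τ * k ^ 2)
    (le_mul_of_one_le_right hy (by nlinarith)) (by linarith)
  have e1 : τ * k ^ 2 * (2 + k * ε) ^ 2 - 4 * (τ * k ^ 2) = τ * k ^ 2 * ((k * ε) * (4 + k * ε)) := by
    ring
  have e2 : |τ * k ^ 2 * (2 + k * ε) ^ 2 - 4 * (τ * k ^ 2)| ≤ τ * k ^ 2 * ((|k| * ε) * 5) := by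
    rw [e1, abs_mul, abs_of_nonneg hy, abs_mul, abs_mul, abs_of_pos hε]
    have : |4 + k * ε| ≤ 5 := by rw [abs_le]; constructor <;> linarith
    gcongr
  have e3 : (-τ * k ^ 2 * (2 + k * ε) ^ 2) = -(τ * k ^ 2 * (2 + k * ε) ^ 2) := by ring
  have e4 : (-4 * τ * k ^ 2) = -(4 * (τ * k ^ 2)) := by ring
  rw [e3, e4, ← sq_abs]
  generalize τ * k ^ 2 = y at *
  have hq := Real.quadratic_le_exp_of_nonneg hy
  have hE := Real.exp_pos (-y)
  have hm : Real.exp (-y) * Real.exp y = 1 := by rw [← Real.exp_add]; simp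
  have hy2 : Real.exp (-y) * y ^ 2 ≤ 2 := by nlinarith
  calc _ ≤ (Real.exp (-y) * (y * ((|k| * ε) * 5))) ^ 2 := by
        gcongr
        exact h.trans (by gcongr)
    _ = 25 * (Real.exp (-y) * y ^ 2) * (Real.exp (-y) * (|k| * ε) ^ 2) := by ring
    _ ≤ 25 * 2 * (Real.exp (-y) * (|k| * ε) ^ 2) := by gcongr
    _ = _ := by ring

lemma fker_bound (T κ ε ν τ k : ℝ) (hκ0 : 0 < κ) (hκ1 : κ < 1) (hε : 0 < ε) (hτ : 0 < τ)
    (hτT : τ ≤ T) (hν : |ν| ≤ 1) :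
    fker ε ν τ k ^ 2 ≤
      50 * Real.exp (2 * T) * Real.exp (-(τ * k ^ 2)) * (|k| * ε) ^ (1 - κ) := by
  have hx0 : 0 ≤ |k| * ε := by positivity
  have hy : 0 ≤ τ * k ^ 2 := by positivity
  have hexp : Real.exp (τ * ν) ^ 2 ≤ Real.exp (2 * T) := by
    rw [← Real.exp_nat_mul]
    apply Real.exp_le_exp.2
    push_cast
    nlinarith [(abs_le.1 hν).2]
  have key : ∃ g, fker ε ν τ k = Real.exp (τ * ν) * g ∧
      g ^ 2 ≤ 50 * Real.exp (-(τ * k ^ 2)) * (|k| * ε) ^ (1 - κ) := by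
    have hb4 : Real.exp (-4 * τ * k ^ 2) ≤ Real.exp (-(τ * k ^ 2)) :=
      Real.exp_le_exp.2 (by nlinarith)
    have hE1 : Real.exp (-(τ * k ^ 2)) ≤ 1 := Real.exp_le_one_iff.2 (by linarith)
    have big : ∀ g, |g| ≤ Real.exp (-(τ * k ^ 2)) → 1 ≤ |k| * ε →
        g ^ 2 ≤ 50 * Real.exp (-(τ * k ^ 2)) * (|k| * ε) ^ (1 - κ) := by
      intro g hg h1
      have h2 : 1 ≤ (|k| * ε) ^ (1 - κ) := Real.one_le_rpow h1 (by linarith)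
      have hE := Real.exp_pos (-(τ * k ^ 2))
      calc g ^ 2 = |g| ^ 2 := (sq_abs g).symm
        _ ≤ Real.exp (-(τ * k ^ 2)) ^ 2 := by gcongr
        _ ≤ 50 * Real.exp (-(τ * k ^ 2)) * 1 := by nlinarith
        _ ≤ _ := by gcongr
    unfold fker
    split_ifs with hk
    · refine ⟨_, rfl, ?_⟩
      rcases le_total (|k| * ε) 1 with h1 | h1
      · refine (core_bound ε τ k hε hτ hk h1).trans ?_
        gcongr
        rcases hx0.eq_or_lt with h0 | h0
        · rw [← h0, Real.zero_rpow (by linarith)]; simp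
        · rw [← Real.rpow_natCast]
          exact Real.rpow_le_rpow_of_exponent_ge h0 h1 (by push_cast; linarith)
      · apply big _ _ h1
        have hk' : -1 ≤ k * ε := by rwa [div_le_iff₀ hε] at hk
        have : Real.exp (-τ * k ^ 2 * (2 + k * ε) ^ 2) ≤ Real.exp (-(τ * k ^ 2)) :=
          Real.exp_le_exp.2 (by
            have : 1 ≤ (2 + k * ε) ^ 2 := by nlinarith
            nlinarith)
        have p1 := Real.exp_pos (-τ * k ^ 2 * (2 + k * ε) ^ 2)
        have p2 := Real.exp_pos (-4 * τ * k ^ 2)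
        rw [abs_le]; constructor <;> linarith
    · refine ⟨-Real.exp (-4 * τ * k ^ 2), by ring, ?_⟩
      apply big
      · rw [abs_neg, abs_of_pos (Real.exp_pos _)]; exact hb4
      · rw [not_le, lt_div_iff₀ hε] at hk
        nlinarith [neg_abs_le k]
  obtain ⟨g, hg, hg2⟩ := key
  rw [hg, mul_pow]
  calc _ ≤ Real.exp (2 * T) * (50 * Real.exp (-(τ * k ^ 2)) * (|k| * ε) ^ (1 - κ)) := by gcongr
    _ = _ := by ring

lemma exp_rpow_bound (T τ k s : ℝ) (hτ : 0 < τ) (hτT : τ ≤ T) (hs0 : 0 < s) (hs1 : s < 1) :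
    Real.exp (-(τ * k ^ 2)) ≤ (T + 1) * (τ ^ (-s) * (1 + k ^ 2) ^ (-s)) := by
  have hy : 0 ≤ τ * k ^ 2 := by positivity
  have hu : 0 < 1 + k ^ 2 := by positivity
  have hE := Real.exp_pos (-(τ * k ^ 2))
  have hE1 : Real.exp (-(τ * k ^ 2)) ≤ 1 := Real.exp_le_one_iff.2 (by linarith)
  have hm : Real.exp (-(τ * k ^ 2)) * Real.exp (τ * k ^ 2) = 1 := by rw [← Real.exp_add]; simp
  have hq := Real.add_one_le_exp (τ * k ^ 2)
  have h1 : Real.exp (-(τ * k ^ 2)) * (τ * (1 + k ^ 2)) ≤ T + 1 := by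
    calc _ ≤ Real.exp (-(τ * k ^ 2)) * ((T + 1) * Real.exp (τ * k ^ 2)) := by
          refine mul_le_mul_of_nonneg_left ?_ hE.le
          nlinarith [mul_le_mul_of_nonneg_left hq (show 0 ≤ T + 1 by linarith), mul_nonneg (show 0 ≤ T by linarith) hy]
      _ = T + 1 := by linear_combination (T + 1) * hm
  have h2 : Real.exp (-(τ * k ^ 2)) ≤ Real.exp (-(τ * k ^ 2)) ^ s := by
    conv_lhs => rw [← Real.rpow_one (Real.exp (-(τ * k ^ 2)))]
    exact Real.rpow_le_rpow_of_exponent_ge hE hE1 hs1.le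
  have h3 : Real.exp (-(τ * k ^ 2)) ≤ (T + 1) * (τ * (1 + k ^ 2))⁻¹ := by
    rw [← div_eq_mul_inv, le_div_iff₀ (by positivity)]; exact h1
  have hT : 0 < T := by linarith
  calc _ ≤ _ := h2
    _ ≤ ((T + 1) * (τ * (1 + k ^ 2))⁻¹) ^ s := by gcongr
    _ = (T + 1) ^ s * (τ ^ (-s) * (1 + k ^ 2) ^ (-s)) := by
      rw [Real.mul_rpow (by positivity) (by positivity), Real.inv_rpow (by positivity),
        Real.mul_rpow (by positivity) (by positivity), Real.rpow_neg (by positivity),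
        Real.rpow_neg (by positivity), mul_inv]
    _ ≤ _ := by
      gcongr
      exact Real.rpow_le_self_of_one_le (by linarith) hs1.le

lemma weight_bound (κ γ k : ℝ) (hκ0 : 0 < κ) (hκ1 : κ < 1) (hγ : 0 < γ) (hγ' : γ < κ / 4) :
    |k| ^ (1 - κ) * (|k| ^ (2 * γ) + 1) ≤ 2 * (1 + k ^ 2) ^ (1 / 2 - κ / 4) := by
  have hu : 1 ≤ 1 + k ^ 2 := by nlinarith [sq_nonneg k]
  have hp : ∀ p : ℝ, 0 ≤ p → |k| ^ (2 * p) ≤ (1 + k ^ 2) ^ p := by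
    intro p hp
    rw [Real.rpow_mul (abs_nonneg k)]
    gcongr
    rw [Real.rpow_two, sq_abs]; linarith
  have h1 := hp ((1 - κ) / 2) (by linarith)
  rw [show 2 * ((1 - κ) / 2) = 1 - κ by ring] at h1
  have h2 := (hp γ hγ.le).trans (Real.rpow_le_rpow_of_exponent_le hu hγ'.le)
  have h3 : 1 ≤ (1 + k ^ 2) ^ (κ / 4) := Real.one_le_rpow hu (by linarith)
  calc _ ≤ (1 + k ^ 2) ^ ((1 - κ) / 2) * ((1 + k ^ 2) ^ (κ / 4) + (1 + k ^ 2) ^ (κ / 4)) := by gcongr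
    _ = 2 * ((1 + k ^ 2) ^ ((1 - κ) / 2) * (1 + k ^ 2) ^ (κ / 4)) := by ring
    _ = _ := by rw [← Real.rpow_add (by linarith)]; ring_nf

lemma total_bound (T κ ε ν τ k γ : ℝ) (hκ0 : 0 < κ) (hκ1 : κ < 1) (hε : 0 < ε) (hτ : 0 < τ)
    (hτT : τ ≤ T) (hν : |ν| ≤ 1) (hγ : 0 < γ) (hγ' : γ < κ / 4) :
    fker ε ν τ k ^ 2 * (|k| ^ (2 * γ) + 1) ≤
      (100 * Real.exp (2 * T) * (T + 1) * ε ^ (1 - κ)) *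
        (τ ^ (-(1 - κ / 8)) * (1 + ‖k‖ ^ 2) ^ (-(1 + κ / 4) / 2)) := by
  have hT : 0 < T := by linarith
  have h1 := fker_bound T κ ε ν τ k hκ0 hκ1 hε hτ hτT hν
  have h2 := exp_rpow_bound T τ k (1 - κ / 8) hτ hτT (by linarith) (by linarith)
  have h3 := weight_bound κ γ k hκ0 hκ1 hγ hγ'
  have hu : 0 < 1 + k ^ 2 := by positivity
  rw [Real.mul_rpow (abs_nonneg _) hε.le] at h1
  rw [Real.norm_eq_abs, sq_abs]
  calc _ ≤ (50 * Real.exp (2 * T) * Real.exp (-(τ * k ^ 2)) * (|k| ^ (1 - κ) * ε ^ (1 - κ))) *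
        (|k| ^ (2 * γ) + 1) := by gcongr
    _ = 50 * Real.exp (2 * T) * ε ^ (1 - κ) * Real.exp (-(τ * k ^ 2)) *
        (|k| ^ (1 - κ) * (|k| ^ (2 * γ) + 1)) := by ring
    _ ≤ 50 * Real.exp (2 * T) * ε ^ (1 - κ) *
        ((T + 1) * (τ ^ (-(1 - κ / 8)) * (1 + k ^ 2) ^ (-(1 - κ / 8)))) *
        (2 * (1 + k ^ 2) ^ (1 / 2 - κ / 4)) := by gcongr
    _ = (100 * Real.exp (2 * T) * (T + 1) * ε ^ (1 - κ)) *
        (τ ^ (-(1 - κ / 8)) * ((1 + k ^ 2) ^ (-(1 - κ / 8)) * (1 + k ^ 2) ^ (1 / 2 - κ / 4))) := by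
      ring
    _ = _ := by rw [← Real.rpow_add hu]; ring_nf

/-- Error estimate in space: for all `T > 0`, `κ ∈ (0,1)` there exist `ε₀, γ₀, C > 0` such that
for all `γ ∈ (0,γ₀)`, `ε ∈ (0,ε₀)` and `|ν| ≤ 1` the squared `L²(0,T;H^γ)`-norm of the error
kernel satisfies `∫_0^T ∫_ℝ |f(τ,k)|² (|k|^{2γ}+1) dk dτ ≤ C ε^{1−κ}`. -/
theorem stmt_11 (T : ℝ) (hT : 0 < T) (κ : ℝ) (hκ : κ ∈ Set.Ioo (0 : ℝ) 1) :
    ∃ ε₀ > (0 : ℝ), ∃ γ₀ > (0 : ℝ), ∃ C > (0 : ℝ),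
      ∀ γ ∈ Set.Ioo (0 : ℝ) γ₀, ∀ ε ∈ Set.Ioo (0 : ℝ) ε₀, ∀ ν : ℝ, |ν| ≤ 1 →
        (∫⁻ τ in Set.Ioc (0 : ℝ) T, ∫⁻ k : ℝ,
            ENNReal.ofReal (fker ε ν τ k ^ 2 * (|k| ^ (2 * γ) + 1))) ≤
          ENNReal.ofReal (C * ε ^ (1 - κ)) := by
  obtain ⟨hκ0, hκ1⟩ := hκ
  have hI : Integrable (fun k : ℝ => (1 + ‖k‖ ^ 2) ^ (-(1 + κ / 4) / 2)) :=
    integrable_rpow_neg_one_add_norm_sq (by simp; linarith)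
  have hJ : IntegrableOn (fun τ : ℝ => τ ^ (-(1 - κ / 8))) (Ioc 0 T) := by
    rw [← intervalIntegrable_iff_integrableOn_Ioc_of_le hT.le]
    exact intervalIntegral.intervalIntegrable_rpow' (by linarith)
  set A := ∫ k : ℝ, (1 + ‖k‖ ^ 2) ^ (-(1 + κ / 4) / 2) with hA
  set B := ∫ τ in Ioc 0 T, τ ^ (-(1 - κ / 8)) with hB
  have hA0 : 0 ≤ A := integral_nonneg fun k => by positivity
  have hB0 : 0 ≤ B := setIntegral_nonneg measurableSet_Ioc fun τ hτ => Real.rpow_nonneg hτ.1.le _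
  refine ⟨1, one_pos, κ / 4, by linarith,
    100 * Real.exp (2 * T) * (T + 1) * (B * A + 1), by positivity, ?_⟩
  intro γ hγ ε hε ν hν
  have hε0 := hε.1
  set D := 100 * Real.exp (2 * T) * (T + 1) * ε ^ (1 - κ) with hD
  have hD0 : 0 ≤ D := by positivity
  have inner : ∀ τ ∈ Ioc 0 T, (∫⁻ k : ℝ,
      ENNReal.ofReal (fker ε ν τ k ^ 2 * (|k| ^ (2 * γ) + 1))) ≤
      ENNReal.ofReal (D * A * τ ^ (-(1 - κ / 8))) := by
    intro τ hτ
    have ht : 0 ≤ τ ^ (-(1 - κ / 8)) := Real.rpow_nonneg hτ.1.le _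
    have e : D * A * τ ^ (-(1 - κ / 8)) =
        ∫ k : ℝ, D * (τ ^ (-(1 - κ / 8)) * (1 + ‖k‖ ^ 2) ^ (-(1 + κ / 4) / 2)) := by
      rw [integral_const_mul, integral_const_mul]; ring
    rw [e, ofReal_integral_eq_lintegral_ofReal ((hI.const_mul _).const_mul _)
      (Filter.Eventually.of_forall fun k => by positivity)]
    exact lintegral_mono fun k => ENNReal.ofReal_le_ofReal
      (total_bound T κ ε ν τ k γ hκ0 hκ1 hε0 hτ.1 hτ.2 hν hγ.1 hγ.2)
  calc _ ≤ ∫⁻ τ in Ioc 0 T, ENNReal.ofReal (D * A * τ ^ (-(1 - κ / 8))) :=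
        setLIntegral_mono' measurableSet_Ioc inner
    _ = ENNReal.ofReal (∫ τ in Ioc 0 T, D * A * τ ^ (-(1 - κ / 8))) := by
        rw [ofReal_integral_eq_lintegral_ofReal (hJ.const_mul _)]
        filter_upwards [ae_restrict_mem measurableSet_Ioc] with τ hτ
        have ht : 0 ≤ τ ^ (-(1 - κ / 8)) := Real.rpow_nonneg hτ.1.le _
        show 0 ≤ D * A * τ ^ (-(1 - κ / 8))
        positivity
    _ ≤ _ := by
        apply ENNReal.ofReal_le_ofReal
        rw [integral_const_mul, ← hB]
        have : 100 * Real.exp (2 * T) * (T + 1) * (B * A + 1) * ε ^ (1 - κ) = D * A * B + D := by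
          rw [hD]; ring
        rw [this]; linarith
end

section
/- Let δ ∈ (0,1), τ ≥ 0, ε > 0, and let k ∈ ℝ satisfy |k| ε ≤ δ. Then | exp(−τ k² (2 + kε)²) − exp(−4 τ k²) | ≤ 5 τ ε |k|³ exp( −(2−δ)² τ k² ). -/
open MeasureTheory Set

theorem exp_sub_aux (a b c : ℝ) (ha : a ≤ c) (hb : b ≤ c) :
    |Real.exp a - Real.exp b| ≤ |a - b| * Real.exp c := by
  have key : ∀ x y : ℝ, x ≤ c → Real.exp x - Real.exp y ≤ |x - y| * Real.exp c := by
    intro x y hx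
    have h1 : Real.exp y = Real.exp x * Real.exp (y - x) := by
      rw [← Real.exp_add]; congr 1; ring
    have h2 := Real.add_one_le_exp (y - x)
    have h3 : Real.exp x - Real.exp y ≤ (x - y) * Real.exp x := by
      rw [h1]; nlinarith [Real.exp_pos x]
    calc _ ≤ (x - y) * Real.exp x := h3
      _ ≤ |x - y| * Real.exp x := by gcongr; exact le_abs_self _
      _ ≤ _ := by gcongr
  rw [abs_le]
  have := key a b ha
  have h := key b a hb
  rw [abs_sub_comm] at h
  constructor <;> linarith

/-- Mean-value-theorem bound for the central part of the error kernel: for `δ ∈ (0,1)`,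
`τ ≥ 0`, `ε > 0` and `|k|ε ≤ δ`,
`|exp(−τk²(2+kε)²) − exp(−4τk²)| ≤ 5τε|k|³ exp(−(2−δ)²τk²)`. -/
theorem stmt_13 (δ : ℝ) (hδ : δ ∈ Set.Ioo (0 : ℝ) 1) (τ : ℝ) (hτ : 0 ≤ τ)
    (ε : ℝ) (hε : 0 < ε) (k : ℝ) (hk : |k| * ε ≤ δ) :
    |Real.exp (-τ * k ^ 2 * (2 + k * ε) ^ 2) - Real.exp (-4 * τ * k ^ 2)| ≤
      5 * τ * ε * |k| ^ 3 * Real.exp (-(2 - δ) ^ 2 * τ * k ^ 2) := by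
  obtain ⟨h0, h1⟩ := hδ
  have hke : |k * ε| ≤ δ := by rwa [abs_mul, abs_of_pos hε]
  obtain ⟨hl, hu⟩ := abs_le.mp hke
  have hm : 0 ≤ τ * k ^ 2 := by positivity
  have h4 : |4 + k * ε| ≤ 5 := by rw [abs_le]; constructor <;> linarith
  refine (exp_sub_aux _ _ (-(2 - δ) ^ 2 * τ * k ^ 2) ?_ ?_).trans ?_
  · have : (2 - δ) ^ 2 ≤ (2 + k * ε) ^ 2 := by
      apply pow_le_pow_left₀ <;> linarith
    nlinarith [mul_le_mul_of_nonneg_left this hm]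
  · have : (2 - δ) ^ 2 ≤ 4 := by nlinarith
    nlinarith [mul_le_mul_of_nonneg_left this hm]
  · gcongr
    have e : -τ * k ^ 2 * (2 + k * ε) ^ 2 - -4 * τ * k ^ 2
        = -(τ * ε * k ^ 3 * (4 + k * ε)) := by ring
    rw [e, abs_neg, abs_mul, abs_mul, abs_mul, abs_of_nonneg hτ, abs_of_pos hε, abs_pow]
    have : 0 ≤ τ * ε * |k| ^ 3 := by positivity
    nlinarith [mul_le_mul_of_nonneg_left h4 this]
end

section
/- For every γ ∈ [0, 1/2), every μ ∈ (0, 1 − 2γ), and every T > 0, there is a constant C > 0 such that for all ε ∈ (0,1) and all δ ∈ (0,1], ε² ∫_0^T τ² ∫_{−δ/ε}^{δ/ε} |k|^{6+2γ} e^{−8 τ k²} dk dτ ≤ C ε^{μ}. -/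
open MeasureTheory Set

lemma aux_pt (γ μ T p ε δ τ k : ℝ) (hγ : 0 ≤ γ) (hμ : 0 < μ) (hμ2 : μ < 1 - 2 * γ)
    (hp : 0 < p) (hε : 0 < ε) (hδ : δ ≤ 1) (hτ : 0 < τ) (hτT : τ ≤ T) (hk : |k| ≤ δ / ε) :
    ε ^ 2 * (τ ^ 2 * |k| ^ (6 + 2 * γ) * Real.exp (-8 * τ * k ^ 2)) ≤
      ε ^ μ * (p ^ p * Real.exp T) * (τ ^ (2 - p)) *
        ((1 + ‖k‖ ^ 2) ^ (-(2 * p - (4 + 2 * γ + μ)) / 2)) := by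
  have hk0 := abs_nonneg k
  have h1 : |k| ^ (6 + 2 * γ) = |k| ^ (2 - μ) * |k| ^ (4 + 2 * γ + μ) := by
    rw [← Real.rpow_add_of_nonneg hk0 (by linarith) (by linarith)]; congr 1; ring
  have h2 : ε ^ 2 * |k| ^ (2 - μ) ≤ ε ^ μ := by
    have hk1 : |k| ≤ ε⁻¹ := hk.trans (by rw [div_eq_mul_inv]; exact mul_le_of_le_one_left (by positivity) hδ)
    calc ε ^ 2 * |k| ^ (2 - μ) ≤ ε ^ 2 * (ε⁻¹) ^ (2 - μ) := by
          gcongr; linarith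
      _ = ε ^ μ := by
          rw [Real.inv_rpow hε.le, ← Real.rpow_neg hε.le, ← Real.rpow_natCast, ← Real.rpow_add hε]
          congr 1; push_cast; ring
  set s := 1 + ‖k‖ ^ 2 with hs
  have hs0 : 0 < s := by positivity
  have hsk : s = 1 + k ^ 2 := by rw [hs, Real.norm_eq_abs, sq_abs]
  have h3 : |k| ^ (4 + 2 * γ + μ) ≤ s ^ ((4 + 2 * γ + μ) / 2) := by
    have : |k| ^ (4 + 2 * γ + μ) = (k ^ 2) ^ ((4 + 2 * γ + μ) / 2) := by
      rw [← sq_abs k, ← Real.rpow_natCast, ← Real.rpow_mul hk0]; congr 1; push_cast; ring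
    rw [this]
    apply Real.rpow_le_rpow (by positivity) (by linarith) (by linarith)
  have h4 : (τ * s) ^ p * Real.exp (-8 * τ * k ^ 2) ≤ p ^ p * Real.exp T := by
    have hx : 0 < τ * s := by positivity
    have : (τ * s) ^ p ≤ p ^ p * Real.exp (τ * s) := by
      have h5 : τ * s ≤ p * Real.exp (τ * s / p) := by
        have := Real.add_one_le_exp (τ * s / p)
        calc τ * s = p * (τ * s / p) := by field_simp
          _ ≤ _ := by gcongr; linarith
      calc (τ * s) ^ p ≤ (p * Real.exp (τ * s / p)) ^ p := by gcongr
        _ = _ := by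
          rw [Real.mul_rpow hp.le (by positivity), ← Real.exp_mul]; congr 2; field_simp
    calc _ ≤ p ^ p * Real.exp (τ * s) * Real.exp (-8 * τ * k ^ 2) := by gcongr
      _ = p ^ p * Real.exp (τ * s + -8 * τ * k ^ 2) := by rw [mul_assoc, Real.exp_add]
      _ ≤ _ := by
        gcongr
        rw [hsk]; nlinarith [mul_nonneg hτ.le (sq_nonneg k)]
  have h6 : s ^ ((4 + 2 * γ + μ) / 2) = s ^ p * s ^ (-(2 * p - (4 + 2 * γ + μ)) / 2) := by
    rw [← Real.rpow_add hs0]; congr 1; ring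
  have h7 : τ ^ 2 = τ ^ p * τ ^ (2 - p) := by
    rw [← Real.rpow_add hτ, ← Real.rpow_natCast]; congr 1; push_cast; ring
  calc ε ^ 2 * (τ ^ 2 * |k| ^ (6 + 2 * γ) * Real.exp (-8 * τ * k ^ 2))
      = (ε ^ 2 * |k| ^ (2 - μ)) * (τ ^ 2 * |k| ^ (4 + 2 * γ + μ) * Real.exp (-8 * τ * k ^ 2)) := by
        rw [h1]; ring
    _ ≤ ε ^ μ * (τ ^ 2 * s ^ ((4 + 2 * γ + μ) / 2) * Real.exp (-8 * τ * k ^ 2)) := by gcongr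
    _ = ε ^ μ * ((τ * s) ^ p * Real.exp (-8 * τ * k ^ 2)) * τ ^ (2 - p) *
          s ^ (-(2 * p - (4 + 2 * γ + μ)) / 2) := by
        rw [h6, h7, Real.mul_rpow hτ.le hs0.le]; ring
    _ ≤ _ := by gcongr

/-- Central-part estimate: for `γ ∈ [0,1/2)`, `μ ∈ (0, 1−2γ)` and `T > 0` there is `C > 0`
such that for all `ε ∈ (0,1)` and all `δ ∈ (0,1]`,
`ε² ∫_0^T τ² ∫_{−δ/ε}^{δ/ε} |k|^{6+2γ} e^{−8τk²} dk dτ ≤ C ε^μ`. -/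
theorem stmt_14 (γ μ T : ℝ) (hγ : γ ∈ Set.Ico (0 : ℝ) (1 / 2))
    (hμ : μ ∈ Set.Ioo (0 : ℝ) (1 - 2 * γ)) (hT : 0 < T) :
    ∃ C > (0 : ℝ), ∀ ε ∈ Set.Ioo (0 : ℝ) 1, ∀ δ ∈ Set.Ioc (0 : ℝ) 1,
      ENNReal.ofReal (ε ^ 2) *
        (∫⁻ τ in Set.Ioc (0 : ℝ) T, ∫⁻ k in Set.Icc (-(δ / ε)) (δ / ε),
          ENNReal.ofReal (τ ^ 2 * |k| ^ (6 + 2 * γ) * Real.exp (-8 * τ * k ^ 2))) ≤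
        ENNReal.ofReal (C * ε ^ μ) := by
  obtain ⟨hγ0, hγ1⟩ := hγ
  obtain ⟨hμ0, hμ1⟩ := hμ
  obtain ⟨p, hp⟩ : ∃ p, p = ((4 + 2 * γ + μ) / 2 + 7 / 2) / 2 := ⟨_, rfl⟩
  have hp0 : 0 < p := by linarith
  set K := p ^ p * Real.exp T with hK
  set g : ℝ → ℝ := fun k => (1 + ‖k‖ ^ 2) ^ (-(2 * p - (4 + 2 * γ + μ)) / 2) with hg
  have hgi : Integrable g := by
    apply integrable_rpow_neg_one_add_norm_sq
    simp; linarith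
  have hfi : IntegrableOn (fun τ : ℝ => τ ^ (2 - p)) (Ioc 0 T) := by
    rw [← intervalIntegrable_iff_integrableOn_Ioc_of_le hT.le]
    apply intervalIntegral.intervalIntegrable_rpow'
    linarith
  set J := ∫⁻ k, ENNReal.ofReal (g k) with hJ
  set I := ∫⁻ τ in Ioc (0 : ℝ) T, ENNReal.ofReal (τ ^ (2 - p)) with hI
  have hJt : J ≠ ⊤ := hgi.lintegral_lt_top.ne
  have hIt : I ≠ ⊤ := hfi.lintegral_lt_top.ne
  have hM : ENNReal.ofReal K * I * J ≠ ⊤ :=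
    ENNReal.mul_ne_top (ENNReal.mul_ne_top ENNReal.ofReal_ne_top hIt) hJt
  refine ⟨(ENNReal.ofReal K * I * J).toReal + 1, by positivity, ?_⟩
  rintro ε ⟨hε0, hε1⟩ δ ⟨hδ0, hδ1⟩
  calc _ = ∫⁻ τ in Set.Ioc (0 : ℝ) T, ∫⁻ k in Set.Icc (-(δ / ε)) (δ / ε),
          ENNReal.ofReal (ε ^ 2 * (τ ^ 2 * |k| ^ (6 + 2 * γ) * Real.exp (-8 * τ * k ^ 2))) := by
        simp_rw [ENNReal.ofReal_mul (sq_nonneg ε)]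
        rw [← lintegral_const_mul' _ _ ENNReal.ofReal_ne_top]
        congr 1; ext τ
        rw [← lintegral_const_mul' _ _ ENNReal.ofReal_ne_top]
    _ ≤ ∫⁻ τ in Set.Ioc (0 : ℝ) T, (ENNReal.ofReal (ε ^ μ * K) * J) *
          ENNReal.ofReal (τ ^ (2 - p)) := by
        apply setLIntegral_mono' measurableSet_Ioc
        rintro τ ⟨hτ0, hτT⟩
        calc _ ≤ ∫⁻ k in Set.Icc (-(δ / ε)) (δ / ε),
              ENNReal.ofReal (ε ^ μ * K * τ ^ (2 - p)) * ENNReal.ofReal (g k) := by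
              apply setLIntegral_mono' measurableSet_Icc
              rintro k hk
              rw [← ENNReal.ofReal_mul (by positivity)]
              exact ENNReal.ofReal_le_ofReal (aux_pt γ μ T p ε δ τ k hγ0 hμ0 hμ1 hp0 hε0 hδ1 hτ0 hτT
                (abs_le.2 hk))
          _ ≤ ENNReal.ofReal (ε ^ μ * K * τ ^ (2 - p)) * J := by
              rw [lintegral_const_mul' _ _ ENNReal.ofReal_ne_top]
              gcongr
              exact setLIntegral_le_lintegral _ _
          _ = _ := by
              rw [ENNReal.ofReal_mul (by positivity)]; ring
    _ = ENNReal.ofReal (ε ^ μ) * (ENNReal.ofReal K * I * J) := by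
        rw [lintegral_const_mul' _ _ (ENNReal.mul_ne_top ENNReal.ofReal_ne_top hJt),
          ENNReal.ofReal_mul (by positivity)]; ring
    _ = ENNReal.ofReal ((ENNReal.ofReal K * I * J).toReal * ε ^ μ) := by
        rw [ENNReal.ofReal_mul ENNReal.toReal_nonneg, ENNReal.ofReal_toReal hM, mul_comm]
    _ ≤ _ := by
        apply ENNReal.ofReal_le_ofReal
        gcongr; linarith
end

section
/- For all T > 0 and all κ ∈ (0,1), there exist ε₀ > 0, γ₀ > 0, and C > 0 such that for all γ ∈ (0, γ₀), all ε ∈ (0, ε₀), and all ν ∈ ℝ with |ν| ≤ 1: sup_{S ∈ (0,T]} S^{−2γ} ∫_0^S ∫_ℝ |f(τ,k)|² dk dτ + sup_{0 ≤ R < S ≤ T} (S−R)^{−2γ} ∫_0^R ∫_ℝ |f(S−R+τ, k) − f(τ,k)|² dk dτ ≤ C ε^{1−κ}. -/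
open MeasureTheory Set

lemma aux_gauss (τ p : ℝ) (hτ : 0 < τ) (hp : 0 ≤ p) :
    ∫⁻ k : ℝ, ENNReal.ofReal (|k| ^ p * Real.exp (-τ * k ^ 2)) =
      ENNReal.ofReal (τ ^ (-(p + 1) / 2) * Real.Gamma ((p + 1) / 2)) := by
  have h1 : ∫ k : ℝ, |k| ^ p * Real.exp (-τ * k ^ 2) =
      τ ^ (-(p + 1) / 2) * Real.Gamma ((p + 1) / 2) := by
    have h := integral_comp_abs (f := fun x : ℝ => x ^ p * Real.exp (-τ * x ^ (2 : ℝ)))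
    rw [integral_rpow_mul_exp_neg_mul_rpow (by norm_num) (by linarith) hτ] at h
    simp only [Real.rpow_two, sq_abs] at h
    rw [h]; ring
  have hpos : 0 < τ ^ (-(p + 1) / 2) * Real.Gamma ((p + 1) / 2) :=
    mul_pos (Real.rpow_pos_of_pos hτ _) (Real.Gamma_pos_of_pos (by linarith))
  have hint : Integrable (fun k : ℝ => |k| ^ p * Real.exp (-τ * k ^ 2)) := by
    by_contra hc
    rw [integral_undef hc] at h1
    linarith
  rw [← ofReal_integral_eq_lintegral_ofReal hint, h1]
  exact Filter.Eventually.of_forall fun k => by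
    simp only [Pi.zero_apply]; positivity

lemma aux_time (R s : ℝ) (hR : 0 ≤ R) (hs : 0 < s) :
    ∫⁻ τ in Ioc (0 : ℝ) R, ENNReal.ofReal (τ ^ (s - 1)) = ENNReal.ofReal (R ^ s / s) := by
  have h1 : ∫ τ in Ioc (0 : ℝ) R, τ ^ (s - 1) = R ^ s / s := by
    rw [← intervalIntegral.integral_of_le hR, integral_rpow (Or.inl (by linarith))]
    simp [Real.zero_rpow hs.ne']
  have hint : IntegrableOn (fun τ : ℝ => τ ^ (s - 1)) (Ioc 0 R) := by
    have := intervalIntegral.intervalIntegrable_rpow' (a := 0) (b := R) (r := s - 1) (by linarith)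
    rwa [intervalIntegrable_iff, uIoc_of_le hR] at this
  rw [← ofReal_integral_eq_lintegral_ofReal hint, h1]
  exact (ae_restrict_mem measurableSet_Ioc).mono fun τ hτ => Real.rpow_nonneg hτ.1.le _

lemma aux_min (x r p q : ℝ) (hx : 0 ≤ x) (hr : 0 < r) (hp : 0 ≤ p) (hq : 0 ≤ q)
    (hpq : p + q ≤ 2) : (min 1 (min x r)) ^ 2 ≤ x ^ p * r ^ q := by
  set u := min 1 (min x r) with hu
  have hu0 : 0 ≤ u := le_min (by norm_num) (le_min hx hr.le)
  have hu1 : u ≤ 1 := min_le_left _ _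
  have hux : u ≤ x := (min_le_right _ _).trans (min_le_left _ _)
  have hur : u ≤ r := (min_le_right _ _).trans (min_le_right _ _)
  rcases hu0.eq_or_lt with h | h
  · rw [← h]
    have : 0 ≤ x ^ p * r ^ q := by positivity
    simpa using this
  · calc u ^ 2 = u ^ (2 : ℝ) := (Real.rpow_two u).symm
      _ ≤ u ^ (p + q) := Real.rpow_le_rpow_of_exponent_ge h hu1 hpq
      _ = u ^ p * u ^ q := Real.rpow_add h _ _
      _ ≤ x ^ p * r ^ q := by gcongr

lemma aux_main (T κ γ ε M h R : ℝ) (hT : 0 < T) (hκ : 0 < κ) (hκ1 : κ < 1) (hγ : 0 < γ)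
    (hγ1 : γ < κ / 8) (hε : 0 < ε) (hh : 0 < h) (hR : 0 ≤ R) (hRT : R ≤ T)
    (F : ℝ → ℝ → ℝ)
    (hF : ∀ τ ∈ Ioc (0 : ℝ) R, ∀ k : ℝ,
      |F τ k| ≤ M * min 1 (min |k * ε| (h / τ)) * Real.exp (-(τ * k ^ 2) / 2)) :
    ENNReal.ofReal (h ^ (-(2 * γ))) *
      ∫⁻ τ in Ioc (0 : ℝ) R, ∫⁻ k : ℝ, ENNReal.ofReal (F τ k ^ 2) ≤
    ENNReal.ofReal (M ^ 2 * Real.Gamma ((2 - κ) / 2) * ((1 + T) * 4 / κ) * ε ^ (1 - κ)) := by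
  have hG : 0 < Real.Gamma ((2 - κ) / 2) := Real.Gamma_pos_of_pos (by linarith)
  have hpt : ∀ τ ∈ Ioc (0 : ℝ) R, ∀ k : ℝ, F τ k ^ 2 ≤
      (M ^ 2 * ε ^ (1 - κ) * (h / τ) ^ (2 * γ)) *
        (|k| ^ (1 - κ) * Real.exp (-τ * k ^ 2)) := by
    intro τ hτ k
    have h1 := aux_min |k * ε| (h / τ) (1 - κ) (2 * γ) (abs_nonneg _) (div_pos hh hτ.1)
      (by linarith) (by linarith) (by linarith)
    calc F τ k ^ 2 = |F τ k| ^ 2 := (sq_abs _).symm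
      _ ≤ (M * min 1 (min |k * ε| (h / τ)) * Real.exp (-(τ * k ^ 2) / 2)) ^ 2 :=
        pow_le_pow_left₀ (abs_nonneg _) (hF τ hτ k) 2
      _ = M ^ 2 * (min 1 (min |k * ε| (h / τ))) ^ 2 * Real.exp (-τ * k ^ 2) := by
        rw [mul_pow, mul_pow, ← Real.exp_nat_mul]; congr 2; push_cast; ring
      _ ≤ M ^ 2 * (|k * ε| ^ (1 - κ) * (h / τ) ^ (2 * γ)) * Real.exp (-τ * k ^ 2) := by
        gcongr
      _ = _ := by
        rw [abs_mul, abs_of_pos hε, Real.mul_rpow (abs_nonneg _) hε.le]; ring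
  have hin : ∀ τ ∈ Ioc (0 : ℝ) R, ∫⁻ k : ℝ, ENNReal.ofReal (F τ k ^ 2) ≤
      ENNReal.ofReal (M ^ 2 * ε ^ (1 - κ) * h ^ (2 * γ) * Real.Gamma ((2 - κ) / 2)) *
        ENNReal.ofReal (τ ^ ((κ / 2 - 2 * γ) - 1)) := by
    intro τ hτ
    have hτ0 : 0 < τ := hτ.1
    have hnn : 0 ≤ M ^ 2 * ε ^ (1 - κ) * (h / τ) ^ (2 * γ) := by positivity
    calc ∫⁻ k : ℝ, ENNReal.ofReal (F τ k ^ 2)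
        ≤ ∫⁻ k : ℝ, ENNReal.ofReal (M ^ 2 * ε ^ (1 - κ) * (h / τ) ^ (2 * γ)) *
          ENNReal.ofReal (|k| ^ (1 - κ) * Real.exp (-τ * k ^ 2)) := by
          refine lintegral_mono fun k => ?_
          rw [← ENNReal.ofReal_mul hnn]
          exact ENNReal.ofReal_le_ofReal (hpt τ hτ k)
      _ = ENNReal.ofReal (M ^ 2 * ε ^ (1 - κ) * (h / τ) ^ (2 * γ)) *
          ENNReal.ofReal (τ ^ (-(1 - κ + 1) / 2) * Real.Gamma ((1 - κ + 1) / 2)) := by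
          rw [lintegral_const_mul' _ _ ENNReal.ofReal_ne_top, aux_gauss τ _ hτ.1 (by linarith)]
      _ = _ := by
          rw [← ENNReal.ofReal_mul hnn, ← ENNReal.ofReal_mul (by positivity)]
          congr 1
          have e1 : τ ^ ((κ / 2 - 2 * γ) - 1) = τ ^ (-(1 - κ + 1) / 2) / τ ^ (2 * γ) := by
            rw [← Real.rpow_sub hτ0]; congr 1; ring
          rw [e1, Real.div_rpow hh.le hτ0.le, show (1 - κ + 1) / 2 = (2 - κ) / 2 by ring]
          ring
  have hs : 0 < κ / 2 - 2 * γ := by linarith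
  calc _ ≤ ENNReal.ofReal (h ^ (-(2 * γ))) * ∫⁻ τ in Ioc (0 : ℝ) R,
        ENNReal.ofReal (M ^ 2 * ε ^ (1 - κ) * h ^ (2 * γ) * Real.Gamma ((2 - κ) / 2)) *
        ENNReal.ofReal (τ ^ ((κ / 2 - 2 * γ) - 1)) :=
        mul_le_mul_right (setLIntegral_mono' measurableSet_Ioc hin) _
    _ = ENNReal.ofReal (M ^ 2 * Real.Gamma ((2 - κ) / 2) *
          (R ^ (κ / 2 - 2 * γ) / (κ / 2 - 2 * γ)) * ε ^ (1 - κ)) := by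
        rw [lintegral_const_mul' _ _ ENNReal.ofReal_ne_top, aux_time R _ hR hs,
          ← ENNReal.ofReal_mul (by positivity), ← ENNReal.ofReal_mul (by positivity)]
        congr 1
        rw [Real.rpow_neg hh.le]
        have := (Real.rpow_pos_of_pos hh (2 * γ)).ne'
        field_simp
    _ ≤ _ := by
        refine ENNReal.ofReal_le_ofReal ?_
        have e2 : R ^ (κ / 2 - 2 * γ) ≤ 1 + T := by
          calc R ^ (κ / 2 - 2 * γ) ≤ (1 + T) ^ (κ / 2 - 2 * γ) := by
                apply Real.rpow_le_rpow hR (by linarith) hs.le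
            _ ≤ (1 + T) ^ (1 : ℝ) :=
                Real.rpow_le_rpow_of_exponent_le (by linarith) (by linarith)
            _ = 1 + T := Real.rpow_one _
        have e3 : R ^ (κ / 2 - 2 * γ) / (κ / 2 - 2 * γ) ≤ (1 + T) * 4 / κ := by
          have : (1 + T) * 4 / κ = (1 + T) / (κ / 4) := by field_simp
          rw [this]
          exact div_le_div₀ (by linarith) e2 (by linarith) (by linarith)
        gcongr

lemma aux_exp_diff (A B y : ℝ) (hA : y ≤ A) (hB : y ≤ B) :
    |Real.exp (-A) - Real.exp (-B)| ≤ |A - B| * Real.exp (-y) := by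
  wlog hAB : A ≤ B generalizing A B
  · rw [abs_sub_comm, abs_sub_comm A]; exact this B A hB hA (le_of_not_ge hAB)
  have h1 : Real.exp (-A) - Real.exp (-B) = Real.exp (-A) * (1 - Real.exp (-(B - A))) := by
    rw [mul_sub, ← Real.exp_add]; ring_nf
  have h2 : 1 - Real.exp (-(B - A)) ≤ B - A := by
    have := Real.add_one_le_exp (-(B - A)); linarith
  have h3 : Real.exp (-B) ≤ Real.exp (-A) := Real.exp_le_exp.2 (by linarith)
  rw [abs_of_nonneg (by linarith), abs_sub_comm, abs_of_nonneg (by linarith : 0 ≤ B - A), h1]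
  have h4 : Real.exp (-A) ≤ Real.exp (-y) := Real.exp_le_exp.2 (by linarith)
  nlinarith [Real.exp_pos (-A), Real.exp_pos (-y)]

lemma aux_yexp (y : ℝ) : y * Real.exp (-y) ≤ 2 * Real.exp (-y / 2) := by
  have h1 : Real.exp (-y) = Real.exp (-y / 2) * Real.exp (-(y / 2)) := by
    rw [← Real.exp_add]; ring_nf
  have h2 : y / 2 * Real.exp (-(y / 2)) ≤ 1 := by
    have := Real.add_one_le_exp (y / 2)
    rw [Real.exp_neg, ← div_eq_mul_inv, div_le_one (Real.exp_pos _)]; linarith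
  rw [h1]
  nlinarith [Real.exp_pos (-y / 2)]

lemma aux_nu (T τ ν : ℝ) (hτ : 0 < τ) (hτT : τ ≤ T) (hν : |ν| ≤ 1) :
    Real.exp (τ * ν) ≤ Real.exp T := by
  apply Real.exp_le_exp.2
  have := (abs_le.1 hν).2
  nlinarith

lemma aux_P1 (T ε ν τ k : ℝ) (hε : 0 < ε) (hν : |ν| ≤ 1) (hτ : 0 < τ) (hτT : τ ≤ T) :
    |fker ε ν τ k| ≤ 10 * Real.exp T * min 1 |k * ε| * Real.exp (-(τ * k ^ 2) / 2) := by
  have hE := aux_nu T τ ν hτ hτT hν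
  set y := τ * k ^ 2 with hy
  have hy0 : 0 ≤ y := by positivity
  have hyy : Real.exp (-y) ≤ Real.exp (-y / 2) := Real.exp_le_exp.2 (by linarith)
  have hTp := Real.exp_pos T
  have hyp := Real.exp_pos (-y / 2)
  unfold fker
  split_ifs with hk
  · have hk1 : -1 ≤ k * ε := by rwa [div_le_iff₀ hε] at hk
    rw [abs_mul, abs_of_pos (Real.exp_pos _)]
    have hA : y ≤ y * (2 + k * ε) ^ 2 := by
      have : 1 ≤ (2 + k * ε) ^ 2 := by nlinarith
      nlinarith
    have hB : y ≤ 4 * y := by linarith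
    rw [show -τ * k ^ 2 * (2 + k * ε) ^ 2 = -(y * (2 + k * ε) ^ 2) by rw [hy]; ring,
      show -4 * τ * k ^ 2 = -(4 * y) by rw [hy]; ring]
    have key : |Real.exp (-(y * (2 + k * ε) ^ 2)) - Real.exp (-(4 * y))| ≤
        10 * min 1 |k * ε| * Real.exp (-y / 2) := by
      rcases le_total 1 |k * ε| with hx | hx
      · rw [min_eq_left hx]
        have a1 : Real.exp (-(y * (2 + k * ε) ^ 2)) ≤ Real.exp (-y) :=
          Real.exp_le_exp.2 (by linarith)
        have a2 : Real.exp (-(4 * y)) ≤ Real.exp (-y) := Real.exp_le_exp.2 (by linarith)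
        have a3 := Real.exp_pos (-(y * (2 + k * ε) ^ 2))
        have a4 := Real.exp_pos (-(4 * y))
        rw [abs_le]; constructor <;> linarith
      · rw [min_eq_right hx]
        have b1 := aux_exp_diff _ _ y hA hB
        have b2 : |y * (2 + k * ε) ^ 2 - 4 * y| ≤ 5 * |k * ε| * y := by
          rw [show y * (2 + k * ε) ^ 2 - 4 * y = (k * ε) * (4 + k * ε) * y by ring, abs_mul,
            abs_mul, abs_of_nonneg hy0]
          have : |4 + k * ε| ≤ 5 := by
            rw [abs_le] at hx ⊢; constructor <;> linarith
          have := mul_le_mul_of_nonneg_left this (abs_nonneg (k * ε))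
          nlinarith
        have b3 := aux_yexp y
        calc _ ≤ _ := b1
          _ ≤ 5 * |k * ε| * y * Real.exp (-y) := by gcongr
          _ = 5 * |k * ε| * (y * Real.exp (-y)) := by ring
          _ ≤ 5 * |k * ε| * (2 * Real.exp (-y / 2)) := by gcongr
          _ = _ := by ring
    calc _ ≤ Real.exp T * (10 * min 1 |k * ε| * Real.exp (-y / 2)) := by gcongr
      _ = _ := by ring
  · have hk1 : k * ε < -1 := by rwa [not_le, lt_div_iff₀ hε] at hk
    have hx : 1 ≤ |k * ε| := by rw [abs_of_neg (by linarith)]; linarith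
    rw [min_eq_left hx, abs_neg, abs_of_pos (by positivity)]
    have a2 : Real.exp (-4 * τ * k ^ 2) ≤ Real.exp (-y / 2) :=
      Real.exp_le_exp.2 (by rw [hy] at hy0 ⊢; linarith)
    calc _ ≤ Real.exp T * Real.exp (-y / 2) := by gcongr
      _ ≤ _ := by nlinarith [mul_pos hTp hyp]

lemma aux_g (T ν τ h a c : ℝ) (hν : |ν| ≤ 1) (hτ : 0 < τ) (hh : 0 < h) (hT : h + τ ≤ T)
    (hc : 0 ≤ c) (hca : c ≤ a) :
    |Real.exp ((h + τ) * ν) * Real.exp (-(h + τ) * a) - Real.exp (τ * ν) * Real.exp (-τ * a)| ≤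
      Real.exp (2 * T) * (T + 2) * (h / τ) * Real.exp (-(τ * c) / 2) := by
  have hE := aux_nu T τ ν hτ (by linarith) hν
  obtain ⟨hν1, hν2⟩ := abs_le.1 hν
  have ha : 0 ≤ a := hc.trans hca
  have h1 : Real.exp ((h + τ) * ν) * Real.exp (-(h + τ) * a) -
      Real.exp (τ * ν) * Real.exp (-τ * a) =
      Real.exp (τ * ν) * Real.exp (-τ * a) * (Real.exp (h * (ν - a)) - 1) := by
    rw [mul_sub, mul_one, ← Real.exp_add, ← Real.exp_add, ← Real.exp_add]; ring_nf
  have hT1 : 1 ≤ Real.exp T := Real.one_le_exp (by linarith)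
  have h2 : |Real.exp (h * (ν - a)) - 1| ≤ h * (1 + a) * Real.exp T := by
    have hpos : 0 ≤ h * (1 + a) := by positivity
    rcases le_total 0 (ν - a) with hs | hs
    · have hw : 0 ≤ h * (ν - a) := by positivity
      have b1 : Real.exp (h * (ν - a)) ≤ Real.exp T := Real.exp_le_exp.2 (by nlinarith)
      have b2 := aux_exp_diff (-(h * (ν - a))) 0 (-(h * (ν - a))) le_rfl (by linarith)
      simp only [neg_neg, neg_zero, Real.exp_zero, sub_zero, abs_neg, abs_of_nonneg hw] at b2
      calc _ ≤ _ := b2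
        _ ≤ h * (1 + a) * Real.exp T := by gcongr; linarith
    · have b1 := Real.add_one_le_exp (h * (ν - a))
      have b2 : Real.exp (h * (ν - a)) ≤ 1 := Real.exp_le_one_iff.2 (by nlinarith)
      rw [abs_of_nonpos (by linarith)]
      have : h * (1 + a) ≤ h * (1 + a) * Real.exp T := le_mul_of_one_le_right hpos hT1
      nlinarith
  have h3 : (τ + τ * a) * Real.exp (-τ * a) ≤ (T + 2) * Real.exp (-(τ * c) / 2) := by
    have c1 := aux_yexp (τ * a)
    have c0 : 0 ≤ τ * a := by positivity
    have c2 : Real.exp (-(τ * a)) ≤ Real.exp (-(τ * a) / 2) := Real.exp_le_exp.2 (by linarith)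
    have c3 : Real.exp (-(τ * a) / 2) ≤ Real.exp (-(τ * c) / 2) :=
      Real.exp_le_exp.2 (by nlinarith)
    rw [neg_mul]
    have c4 : τ * Real.exp (-(τ * a)) ≤ T * Real.exp (-(τ * c) / 2) :=
      mul_le_mul (by linarith) (c2.trans c3) (Real.exp_pos _).le (by linarith)
    linarith
  rw [h1, abs_mul, abs_of_pos (by positivity)]
  calc Real.exp (τ * ν) * Real.exp (-τ * a) * |Real.exp (h * (ν - a)) - 1|
      ≤ Real.exp T * Real.exp (-τ * a) * (h * (1 + a) * Real.exp T) := by gcongr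
    _ = Real.exp (2 * T) * (h / τ) * ((τ + τ * a) * Real.exp (-τ * a)) := by
      rw [show 2 * T = T + T by ring, Real.exp_add]; field_simp
    _ ≤ Real.exp (2 * T) * (h / τ) * ((T + 2) * Real.exp (-(τ * c) / 2)) := by gcongr
    _ = _ := by ring

lemma aux_P2 (T ε ν τ h k : ℝ) (hε : 0 < ε) (hν : |ν| ≤ 1) (hτ : 0 < τ) (hh : 0 < h)
    (hT : h + τ ≤ T) :
    |fker ε ν (h + τ) k - fker ε ν τ k| ≤
      20 * Real.exp (2 * T) * (T + 2) * (h / τ) * Real.exp (-(τ * k ^ 2) / 2) := by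
  have hT0 : 0 ≤ T := by linarith
  have hb := aux_g T ν τ h (4 * k ^ 2) (k ^ 2) hν hτ hh hT (sq_nonneg k)
    (by nlinarith [sq_nonneg k])
  have hX : 0 ≤ Real.exp (2 * T) * (T + 2) * (h / τ) * Real.exp (-(τ * k ^ 2) / 2) := by
    positivity
  rw [abs_le] at hb
  unfold fker
  rw [show -4 * τ * k ^ 2 = -τ * (4 * k ^ 2) by ring,
    show -4 * (h + τ) * k ^ 2 = -(h + τ) * (4 * k ^ 2) by ring]
  split_ifs with hk
  · have hk1 : -1 ≤ k * ε := by rwa [div_le_iff₀ hε] at hk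
    have ha := aux_g T ν τ h (k ^ 2 * (2 + k * ε) ^ 2) (k ^ 2) hν hτ hh hT (sq_nonneg k)
      (by
        have : 1 ≤ (2 + k * ε) ^ 2 := by nlinarith
        nlinarith [sq_nonneg k])
    rw [mul_assoc (-τ), mul_assoc (-(h + τ))]
    rw [abs_le] at ha ⊢
    constructor <;> nlinarith
  · rw [abs_le]
    constructor <;> nlinarith

lemma aux_P3 (T ε ν τ h k : ℝ) (hε : 0 < ε) (hν : |ν| ≤ 1) (hτ : 0 < τ) (hh : 0 < h)
    (hT : h + τ ≤ T) :
    |fker ε ν (h + τ) k - fker ε ν τ k| ≤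
      20 * Real.exp (2 * T) * (T + 2) * min 1 (min |k * ε| (h / τ)) *
        Real.exp (-(τ * k ^ 2) / 2) := by
  have hT0 : 0 ≤ T := by linarith
  rw [← min_assoc]
  rcases le_total (min 1 |k * ε|) (h / τ) with hm | hm
  · rw [min_eq_left hm]
    have p1 := aux_P1 T ε ν (h + τ) k hε hν (by linarith) hT
    have p2 := aux_P1 T ε ν τ k hε hν hτ (by linarith)
    have e1 : Real.exp (-((h + τ) * k ^ 2) / 2) ≤ Real.exp (-(τ * k ^ 2) / 2) :=
      Real.exp_le_exp.2 (by nlinarith [mul_nonneg hh.le (sq_nonneg k)])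
    have e2 : Real.exp T ≤ Real.exp (2 * T) * (T + 2) := by
      have : Real.exp T ≤ Real.exp (2 * T) := Real.exp_le_exp.2 (by linarith)
      nlinarith [Real.exp_pos (2 * T)]
    have hm0 : 0 ≤ min 1 |k * ε| := le_min zero_le_one (abs_nonneg _)
    calc _ ≤ |fker ε ν (h + τ) k| + |fker ε ν τ k| := abs_sub _ _
      _ ≤ 10 * Real.exp T * min 1 |k * ε| * Real.exp (-(τ * k ^ 2) / 2) +
          10 * Real.exp T * min 1 |k * ε| * Real.exp (-(τ * k ^ 2) / 2) := by
          refine add_le_add (p1.trans ?_) p2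
          gcongr
      _ = 20 * Real.exp T * min 1 |k * ε| * Real.exp (-(τ * k ^ 2) / 2) := by ring
      _ ≤ 20 * (Real.exp (2 * T) * (T + 2)) * min 1 |k * ε| * Real.exp (-(τ * k ^ 2) / 2) := by
          gcongr
      _ = _ := by ring
  · rw [min_eq_right hm]
    exact aux_P2 T ε ν τ h k hε hν hτ hh hT

/-- Error estimate in time (`𝒦_γ`-norm bound): for all `T > 0` and `κ ∈ (0,1)` there exist
`ε₀, γ₀, C > 0` such that for all `γ ∈ (0,γ₀)`, `ε ∈ (0,ε₀)` and `|ν| ≤ 1`,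
`sup_{S∈(0,T]} S^{−2γ} ∫_0^S ∫_ℝ |f(τ,k)|² dk dτ
 + sup_{0≤R<S≤T} (S−R)^{−2γ} ∫_0^R ∫_ℝ |f(S−R+τ,k) − f(τ,k)|² dk dτ ≤ C ε^{1−κ}`. -/
theorem stmt_15 (T : ℝ) (hT : 0 < T) (κ : ℝ) (hκ : κ ∈ Set.Ioo (0 : ℝ) 1) :
    ∃ ε₀ > (0 : ℝ), ∃ γ₀ > (0 : ℝ), ∃ C > (0 : ℝ),
      ∀ γ ∈ Set.Ioo (0 : ℝ) γ₀, ∀ ε ∈ Set.Ioo (0 : ℝ) ε₀, ∀ ν : ℝ, |ν| ≤ 1 →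
        (⨆ (S : ℝ) (_ : S ∈ Set.Ioc (0 : ℝ) T),
            ENNReal.ofReal (S ^ (-(2 * γ))) *
              ∫⁻ τ in Set.Ioc (0 : ℝ) S, ∫⁻ k : ℝ,
                ENNReal.ofReal (fker ε ν τ k ^ 2)) +
        (⨆ (R : ℝ) (S : ℝ) (_ : 0 ≤ R) (_ : R < S) (_ : S ≤ T),
            ENNReal.ofReal ((S - R) ^ (-(2 * γ))) *
              ∫⁻ τ in Set.Ioc (0 : ℝ) R, ∫⁻ k : ℝ,
                ENNReal.ofReal ((fker ε ν (S - R + τ) k - fker ε ν τ k) ^ 2)) ≤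
          ENNReal.ofReal (C * ε ^ (1 - κ)) := by
  obtain ⟨hκ0, hκ1⟩ := hκ
  set C₁ : ℝ := (20 * Real.exp (2 * T) * (T + 2)) ^ 2 * Real.Gamma ((2 - κ) / 2) *
    ((1 + T) * 4 / κ) with hC₁
  have hG : 0 < Real.Gamma ((2 - κ) / 2) := Real.Gamma_pos_of_pos (by linarith)
  have hC₁pos : 0 < C₁ := by positivity
  refine ⟨1, one_pos, κ / 8, by linarith, C₁ + C₁, by linarith, ?_⟩
  rintro γ ⟨hγ0, hγ1⟩ ε ⟨hε, -⟩ ν hν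
  have hεp : 0 < ε ^ (1 - κ) := Real.rpow_pos_of_pos hε _
  rw [add_mul, ENNReal.ofReal_add (by positivity) (by positivity)]
  refine add_le_add ?_ ?_
  · refine iSup₂_le fun S hS => ?_
    refine aux_main T κ γ ε _ S S hT hκ0 hκ1 hγ0 hγ1 hε hS.1 hS.1.le hS.2 (fker ε ν) ?_
    intro τ hτ k
    have hr : 1 ≤ S / τ := by rw [le_div_iff₀ hτ.1]; linarith [hτ.2]
    rw [← min_assoc, min_eq_left ((min_le_left _ _).trans hr)]
    refine (aux_P1 T ε ν τ k hε hν hτ.1 (hτ.2.trans hS.2)).trans ?_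
    have e2 : 10 * Real.exp T ≤ 20 * Real.exp (2 * T) * (T + 2) := by
      have : Real.exp T ≤ Real.exp (2 * T) := Real.exp_le_exp.2 (by linarith)
      nlinarith [Real.exp_pos (2 * T)]
    have hm0 : 0 ≤ min 1 |k * ε| := le_min zero_le_one (abs_nonneg _)
    gcongr
  · refine iSup₂_le fun R S => iSup₂_le fun hR hRS => iSup_le fun hST => ?_
    refine aux_main T κ γ ε _ (S - R) R hT hκ0 hκ1 hγ0 hγ1 hε (by linarith) hR (by linarith)
      (fun τ k => fker ε ν (S - R + τ) k - fker ε ν τ k) ?_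
    intro τ hτ k
    exact aux_P3 T ε ν τ (S - R) k hε hν hτ.1 (by linarith) (by linarith [hτ.2])
end

section
/- Let q : ℝ → [0,∞) be measurable with q(k) ≤ C₀ and q(k) ≤ C₀/k² for all k ≠ 0, for some C₀ > 0. Then for every T > 0 and every γ ∈ (0, 1/10] there is a constant C > 0 such that for all ε ∈ (0,1) and all ν ∈ ℝ with |ν| ≤ 1, sup_{S, R ∈ [0,T], S ≠ R} |S − R|^{−2γ} ∫_ℝ q(k) |f(S,k) − f(R,k)|² dk ≤ C (ε^{1−4γ} + ε^{1/5}). -/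
open MeasureTheory Set

open Real in
lemma aux_exp_diff_s17 (a b c τ : ℝ) (ha : c ≤ a) (hb : c ≤ b) (hτ : 0 ≤ τ) :
    |exp (-(τ * a)) - exp (-(τ * b))| ≤ τ * |a - b| * exp (-(τ * c)) := by
  wlog hab : a ≤ b generalizing a b
  · have := this b a hb ha (le_of_not_ge hab)
    rwa [abs_sub_comm, abs_sub_comm b a] at this
  have h1 : exp (-(τ * b)) = exp (-(τ * a)) * exp (-(τ * (b - a))) := by
    rw [← exp_add]; ring_nf
  have h2 : -(τ * (b - a)) + 1 ≤ exp (-(τ * (b - a))) := add_one_le_exp _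
  have h3 : exp (-(τ * a)) ≤ exp (-(τ * c)) := by
    apply exp_le_exp.2; nlinarith
  have h5 : exp (-(τ * b)) ≤ exp (-(τ * a)) := by
    apply exp_le_exp.2; nlinarith
  rw [abs_of_nonneg (by linarith), abs_of_nonpos (by linarith), h1]
  have h4 : 0 ≤ τ * (b - a) := mul_nonneg hτ (by linarith)
  have := exp_pos (-(τ * a))
  calc exp (-(τ * a)) - exp (-(τ * a)) * exp (-(τ * (b - a)))
      = exp (-(τ * a)) * (1 - exp (-(τ * (b - a)))) := by ring
    _ ≤ exp (-(τ * a)) * (τ * (b - a)) := by gcongr; linarith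
    _ ≤ exp (-(τ * c)) * (τ * (b - a)) := by gcongr
    _ = _ := by ring

lemma aux_ue (u : ℝ) : u * Real.exp (-u) ≤ 1 := by
  have h := Real.add_one_le_exp u
  rw [Real.exp_neg, ← div_eq_mul_inv, div_le_one (Real.exp_pos _)]
  linarith

/-- small-frequency bounds -/
lemma aux_small (k ε τ : ℝ) (hτ : 0 ≤ τ) (hx : |k * ε| ≤ 1 / 2) :
    |Real.exp (-(τ * (k ^ 2 * (2 + k * ε) ^ 2))) - Real.exp (-(τ * (4 * k ^ 2)))| ≤ 5 * |k * ε| ∧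
    |k ^ 2 * (2 + k * ε) ^ 2 * Real.exp (-(τ * (k ^ 2 * (2 + k * ε) ^ 2)))
      - 4 * k ^ 2 * Real.exp (-(τ * (4 * k ^ 2)))| ≤ 25 * k ^ 2 * |k * ε| := by
  set y := k * ε with hy
  obtain ⟨hx1, hx2⟩ := abs_le.1 hx
  have hk : 0 ≤ k ^ 2 := sq_nonneg k
  set a := k ^ 2 * (2 + y) ^ 2 with ha
  have hka : k ^ 2 ≤ a := by
    have : 1 ≤ (2 + y) ^ 2 := by nlinarith
    nlinarith
  have hab : |a - 4 * k ^ 2| ≤ 5 * k ^ 2 * |y| := by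
    have : a - 4 * k ^ 2 = k ^ 2 * (4 + y) * y := by rw [ha]; ring
    rw [this, abs_mul, abs_of_nonneg (mul_nonneg hk (by linarith))]
    gcongr ?_ * _
    nlinarith
  have h1 := aux_exp_diff_s17 a (4 * k ^ 2) (k ^ 2) τ hka (by linarith) hτ
  have hue := aux_ue (τ * k ^ 2)
  have hy0 := abs_nonneg y
  have hA : |Real.exp (-(τ * a)) - Real.exp (-(τ * (4 * k ^ 2)))| ≤ 5 * |y| := by
    have he := Real.exp_pos (-(τ * k ^ 2))
    calc _ ≤ _ := h1
      _ ≤ τ * (5 * k ^ 2 * |y|) * Real.exp (-(τ * k ^ 2)) := by gcongr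
      _ = 5 * |y| * (τ * k ^ 2 * Real.exp (-(τ * k ^ 2))) := by ring
      _ ≤ 5 * |y| * 1 := by gcongr
      _ = _ := by ring
  refine ⟨hA, ?_⟩
  have he : Real.exp (-(τ * a)) ≤ 1 := Real.exp_le_one_iff.2 (by nlinarith)
  have he0 := Real.exp_pos (-(τ * a))
  calc |a * Real.exp (-(τ * a)) - 4 * k ^ 2 * Real.exp (-(τ * (4 * k ^ 2)))|
      = |(a - 4 * k ^ 2) * Real.exp (-(τ * a)) + 4 * k ^ 2 * (Real.exp (-(τ * a)) - Real.exp (-(τ * (4 * k ^ 2))))| := by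
        congr 1; ring
    _ ≤ _ := abs_add_le _ _
    _ = |a - 4 * k ^ 2| * Real.exp (-(τ * a)) + 4 * k ^ 2 * |Real.exp (-(τ * a)) - Real.exp (-(τ * (4 * k ^ 2)))| := by
        rw [abs_mul, abs_mul, abs_of_pos he0, abs_of_nonneg (by positivity : 0 ≤ 4 * k ^ 2)]
    _ ≤ 5 * k ^ 2 * |y| * 1 + 4 * k ^ 2 * (5 * |y|) := by gcongr
    _ = _ := by ring

lemma aux_exp_le (T ν τ : ℝ) (hτ : τ ∈ Icc 0 T) (hν : |ν| ≤ 1) :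
    Real.exp (τ * ν) ≤ Real.exp T := by
  apply Real.exp_le_exp.2
  have := abs_le.1 hν
  nlinarith [hτ.1, hτ.2]

lemma aux_bd (T ε ν τ k : ℝ) (hε : ε ∈ Ioo (0 : ℝ) 1) (hν : |ν| ≤ 1) (hτ : τ ∈ Icc 0 T) :
    |fker ε ν τ k| ≤ 25 * Real.exp T * min 1 |k * ε| ∧
    ∃ d, HasDerivAt (fun t => fker ε ν t k) d τ ∧
      |d| ≤ 25 * Real.exp T * min 1 |k * ε| * ((1 + k ^ 2) * (1 + (k * ε) ^ 2)) := by
  have hE := aux_exp_le T ν τ hτ hν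
  have hE0 := Real.exp_pos (τ * ν)
  have hT0 := Real.exp_pos T
  have hτ0 := hτ.1
  have hk : 0 ≤ k ^ 2 := sq_nonneg k
  have hder : ∀ c : ℝ, HasDerivAt (fun t => Real.exp (-(t * c))) (-(c * Real.exp (-(τ * c)))) τ := by
    intro c
    have := (((hasDerivAt_id τ).mul_const c).neg).exp
    have e : -(c * Real.exp (-(τ * c))) = Real.exp (-(τ * c)) * -(1 * c) := by ring
    rw [e]; exact this
  have hderν : HasDerivAt (fun t => Real.exp (t * ν)) (ν * Real.exp (τ * ν)) τ := by
    have := ((hasDerivAt_id τ).mul_const ν).exp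
    have e : ν * Real.exp (τ * ν) = Real.exp (τ * ν) * (1 * ν) := by ring
    rw [e]; exact this
  have hy2 : |k * ε| ^ 2 = (k * ε) ^ 2 := sq_abs _
  have hexp1 : ∀ c : ℝ, 0 ≤ c → Real.exp (-(τ * c)) ≤ 1 := fun c hc =>
    Real.exp_le_one_iff.2 (by nlinarith)
  have hy0 := abs_nonneg (k * ε)
  by_cases hc : -1 / ε ≤ k
  · set a := k ^ 2 * (2 + k * ε) ^ 2 with ha
    have ha0 : 0 ≤ a := by positivity
    have hf : ∀ t, fker ε ν t k = Real.exp (t * ν) * (Real.exp (-(t * a)) - Real.exp (-(t * (4 * k ^ 2)))) := by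
      intro t
      rw [fker, if_pos hc, ha]
      ring_nf
    have key : |Real.exp (-(τ * a)) - Real.exp (-(τ * (4 * k ^ 2)))| ≤ 5 * min 1 |k * ε| ∧
        |a * Real.exp (-(τ * a)) - 4 * k ^ 2 * Real.exp (-(τ * (4 * k ^ 2)))| ≤
          25 * min 1 |k * ε| * (k ^ 2 * (1 + (k * ε) ^ 2)) := by
      by_cases hx : |k * ε| ≤ 1 / 2
      · obtain ⟨h1, h2⟩ := aux_small k ε τ hτ0 hx
        rw [min_eq_right (by linarith)]
        refine ⟨h1, h2.trans ?_⟩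
        have : 0 ≤ 25 * k ^ 2 * |k * ε| * (k * ε) ^ 2 := by positivity
        nlinarith
      · push Not at hx
        have hm : 1 / 2 ≤ min 1 |k * ε| := le_min (by norm_num) hx.le
        have e1 := hexp1 a ha0
        have e2 := hexp1 (4 * k ^ 2) (by positivity)
        have e1' := Real.exp_pos (-(τ * a))
        have e2' := Real.exp_pos (-(τ * (4 * k ^ 2)))
        refine ⟨abs_le.2 ⟨by linarith, by linarith⟩, ?_⟩
        have haa : a ≤ 8 * (k ^ 2 * (1 + (k * ε) ^ 2)) := by
          have : (2 + k * ε) ^ 2 ≤ 8 * (1 + (k * ε) ^ 2) := by nlinarith [sq_nonneg (k * ε - 2)]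
          calc a ≤ k ^ 2 * (8 * (1 + (k * ε) ^ 2)) := by rw [ha]; gcongr
            _ = _ := by ring
        have hkk : k ^ 2 ≤ k ^ 2 * (1 + (k * ε) ^ 2) := by nlinarith [mul_nonneg hk (sq_nonneg (k * ε))]
        have h1 : a * Real.exp (-(τ * a)) ≤ a := by nlinarith
        have h2 : 4 * k ^ 2 * Real.exp (-(τ * (4 * k ^ 2))) ≤ 4 * k ^ 2 := by nlinarith
        have h1' : 0 ≤ a * Real.exp (-(τ * a)) := by positivity
        have h2' : 0 ≤ 4 * k ^ 2 * Real.exp (-(τ * (4 * k ^ 2))) := by positivity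
        have h3 : 1 / 2 * (k ^ 2 * (1 + (k * ε) ^ 2)) ≤ min 1 |k * ε| * (k ^ 2 * (1 + (k * ε) ^ 2)) := by
          gcongr
        exact abs_le.2 ⟨by linarith, by linarith⟩
    obtain ⟨k1, k2⟩ := key
    set m := min 1 |k * ε| with hm
    have hm0 : 0 ≤ m := le_min zero_le_one hy0
    constructor
    · rw [hf, abs_mul, abs_of_pos hE0]
      calc _ ≤ Real.exp T * (5 * m) := by gcongr
        _ ≤ _ := by nlinarith [mul_nonneg hT0.le hm0]
    · have hfe := funext hf
      have hdd := hderν.mul ((hder a).sub (hder (4 * k ^ 2)))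
      refine ⟨_, by rw [hfe]; exact hdd, ?_⟩
      · have e : ∀ E A B : ℝ, ν * E * (A - B) + E * (-(a * A) - -(4 * k ^ 2 * B))
          = E * (ν * (A - B) + -(a * A - 4 * k ^ 2 * B)) := by intros; ring
        rw [Pi.sub_apply, e, abs_mul, abs_of_pos hE0]
        have h6 : |ν * (Real.exp (-(τ * a)) - Real.exp (-(τ * (4 * k ^ 2)))) +
            -(a * Real.exp (-(τ * a)) - 4 * k ^ 2 * Real.exp (-(τ * (4 * k ^ 2))))| ≤
            1 * (5 * m) + 25 * m * (k ^ 2 * (1 + (k * ε) ^ 2)) := by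
          refine (abs_add_le _ _).trans ?_
          rw [abs_neg, abs_mul]
          gcongr
        calc _ ≤ Real.exp T * (1 * (5 * m) + 25 * m * (k ^ 2 * (1 + (k * ε) ^ 2))) := by gcongr
          _ ≤ Real.exp T * (25 * m * ((1 + k ^ 2) * (1 + (k * ε) ^ 2))) := by
            refine mul_le_mul_of_nonneg_left ?_ hT0.le
            nlinarith [mul_nonneg hm0 (sq_nonneg (k * ε))]
          _ = _ := by ring
  · have hf : ∀ t, fker ε ν t k = -(Real.exp (t * ν) * Real.exp (-(t * (4 * k ^ 2)))) := by
      intro t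
      rw [fker, if_neg hc]
      ring_nf
    have hm : min 1 |k * ε| = 1 := by
      apply min_eq_left
      push Not at hc
      rw [lt_div_iff₀ hε.1] at hc
      rw [abs_of_neg (by linarith)]; linarith
    rw [hm]
    have e2 := hexp1 (4 * k ^ 2) (by positivity)
    have e2' := Real.exp_pos (-(τ * (4 * k ^ 2)))
    constructor
    · rw [hf, abs_neg, abs_mul, abs_of_pos hE0, abs_of_pos e2']
      calc _ ≤ Real.exp T * 1 := by gcongr
        _ ≤ _ := by linarith
    · have hfe := funext hf
      have hdd := (hderν.mul (hder (4 * k ^ 2))).neg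
      refine ⟨_, by rw [hfe]; exact hdd, ?_⟩
      · have e : ∀ E B : ℝ, -(ν * E * B + E * (-(4 * k ^ 2 * B)))
          = E * (B * (-ν + 4 * k ^ 2)) := by intros; ring
        rw [e, abs_mul, abs_of_pos hE0, abs_mul, abs_of_pos e2']
        have h6 : |-ν + 4 * k ^ 2| ≤ 1 + 4 * k ^ 2 := by
          have := abs_le.1 hν
          exact abs_le.2 ⟨by linarith, by linarith⟩
        calc _ ≤ Real.exp T * (1 * (1 + 4 * k ^ 2)) := by gcongr
          _ ≤ Real.exp T * (25 * 1 * ((1 + k ^ 2) * (1 + (k * ε) ^ 2))) := by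
            refine mul_le_mul_of_nonneg_left ?_ hT0.le
            nlinarith [mul_nonneg hk (sq_nonneg (k * ε)), sq_nonneg (k * ε)]
          _ = _ := by ring

lemma aux_sq (T ε ν S R k γ : ℝ) (hε : ε ∈ Ioo (0 : ℝ) 1) (hν : |ν| ≤ 1) (hS : S ∈ Icc 0 T)
    (hR : R ∈ Icc 0 T) (hγ : γ ∈ Ioc (0 : ℝ) (1 / 10)) :
    (fker ε ν S k - fker ε ν R k) ^ 2 ≤ (50 * Real.exp T) ^ 2 * (min 1 |k * ε|) ^ 2 *
      (((1 + k ^ 2) * (1 + (k * ε) ^ 2)) ^ (2 * γ) * |S - R| ^ (2 * γ)) := by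
  set m := min 1 |k * ε| with hm
  have hm0 : 0 ≤ m := le_min zero_le_one (abs_nonneg _)
  set L := (1 + k ^ 2) * (1 + (k * ε) ^ 2) with hL
  have hL0 : 0 ≤ L := by positivity
  have hT0 := Real.exp_pos T
  set P := 50 * Real.exp T * m with hP
  have hP0 : 0 ≤ P := by positivity
  have hA : |fker ε ν S k - fker ε ν R k| ≤ P := by
    have h1 := (aux_bd T ε ν S k hε hν hS).1
    have h2 := (aux_bd T ε ν R k hε hν hR).1
    have := abs_sub (fker ε ν S k) (fker ε ν R k)
    linarith
  have hB : |fker ε ν S k - fker ε ν R k| ≤ P * (L * |S - R|) := by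
    have := (convex_Icc (0 : ℝ) T).norm_image_sub_le_of_norm_deriv_le
      (f := fun t => fker ε ν t k) (C := 25 * Real.exp T * m * L) (x := R) (y := S) ?_ ?_ hR hS
    · rw [Real.norm_eq_abs, Real.norm_eq_abs] at this
      refine this.trans ?_
      have : 0 ≤ Real.exp T * m * L * |S - R| := by positivity
      nlinarith
    · intro t ht
      obtain ⟨d, hd, _⟩ := (aux_bd T ε ν t k hε hν ht).2
      exact hd.differentiableAt
    · intro t ht
      obtain ⟨d, hd, hd'⟩ := (aux_bd T ε ν t k hε hν ht).2
      rw [hd.deriv]; exact hd'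
  set u := L * |S - R| with hu
  have hu0 : 0 ≤ u := by positivity
  rw [← Real.mul_rpow hL0 (abs_nonneg _), ← mul_pow, ← hP, ← hu, ← sq_abs]
  have h2γ : 0 ≤ 2 * γ := by linarith [hγ.1]
  by_cases h1 : u ≤ 1
  · have h3 : u ^ 2 ≤ u ^ (2 * γ) := by
      rcases hu0.eq_or_lt with h | h
      · rw [← h]; simp [Real.rpow_nonneg]
      · have := Real.rpow_le_rpow_of_exponent_ge h h1 (by linarith [hγ.2] : 2 * γ ≤ 2)
        simpa using this
    calc _ ≤ (P * u) ^ 2 := by gcongr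
      _ = P ^ 2 * u ^ 2 := by ring
      _ ≤ _ := by gcongr
  · have h3 : 1 ≤ u ^ (2 * γ) := Real.one_le_rpow (by linarith) h2γ
    calc _ ≤ P ^ 2 * 1 := by rw [mul_one]; gcongr
      _ ≤ _ := by gcongr

lemma aux_alg (ε k γ : ℝ) (hε : ε ∈ Ioo (0 : ℝ) 1) (hγ : γ ∈ Ioc (0 : ℝ) (1 / 10)) :
    (1 + k ^ 2)⁻¹ * ((min 1 |k * ε|) ^ 2 * ((1 + k ^ 2) * (1 + (k * ε) ^ 2)) ^ (2 * γ)) ≤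
      2 * (ε ^ (1 - 4 * γ) * ε) * (1 + (k * ε) ^ 2) ^ (4 * γ - 1) := by
  have hε0 := hε.1
  rcases eq_or_ne k 0 with rfl | hk0
  · simp; positivity
  have hk : 0 < k ^ 2 := by positivity
  set x2 := (k * ε) ^ 2 with hx2
  have hx0 : 0 < x2 := by positivity
  have hmin : (min 1 |k * ε|) ^ 2 ≤ 2 * x2 * (1 + x2)⁻¹ := by
    rw [← div_eq_mul_inv, le_div_iff₀ (by positivity)]
    have h1 : (min 1 |k * ε|) ^ 2 ≤ 1 := pow_le_one₀ (le_min zero_le_one (abs_nonneg _)) (min_le_left _ _)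
    have h2 : (min 1 |k * ε|) ^ 2 ≤ x2 := by
      rw [hx2, ← sq_abs (k * ε)]
      exact pow_le_pow_left₀ (le_min zero_le_one (abs_nonneg _)) (min_le_right _ _) 2
    nlinarith
  have e1 : (1 + k ^ 2)⁻¹ * (1 + k ^ 2) ^ (2 * γ) ≤ (k ^ 2) ^ (2 * γ - 1) := by
    rw [mul_comm, ← div_eq_mul_inv, ← Real.rpow_sub_one (by positivity)]
    exact Real.rpow_le_rpow_of_nonpos hk (by linarith) (by linarith [hγ.2])
  have e2 : (k ^ 2) ^ (2 * γ - 1) * x2 = ε ^ (1 - 4 * γ) * ε * x2 ^ (2 * γ) := by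
    rw [hx2, mul_pow, Real.mul_rpow hk.le (by positivity), Real.rpow_sub_one hk.ne']
    have : (ε ^ 2) ^ (2 * γ) = ε ^ (4 * γ) := by
      rw [← Real.rpow_natCast, ← Real.rpow_mul hε0.le]; congr 1; push_cast; ring
    rw [this, Real.rpow_sub hε0, Real.rpow_one]
    have := Real.rpow_pos_of_pos hε0 (4 * γ)
    field_simp
  have e3 : x2 ^ (2 * γ) ≤ (1 + x2) ^ (2 * γ) :=
    Real.rpow_le_rpow hx0.le (by linarith) (by linarith [hγ.1])
  have e4 : (1 + x2) ^ (2 * γ) * ((1 + x2) ^ (2 * γ) * (1 + x2)⁻¹) = (1 + x2) ^ (4 * γ - 1) := by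
    rw [Real.rpow_sub_one (by positivity), div_eq_mul_inv, ← mul_assoc, ← Real.rpow_add (by positivity)]
    congr 2; ring
  have hεp := Real.rpow_pos_of_pos hε0 (1 - 4 * γ)
  rw [Real.mul_rpow (by positivity) (by positivity)]
  calc _ = ((1 + k ^ 2)⁻¹ * (1 + k ^ 2) ^ (2 * γ)) * (min 1 |k * ε|) ^ 2 * (1 + x2) ^ (2 * γ) := by ring
    _ ≤ (k ^ 2) ^ (2 * γ - 1) * (2 * x2 * (1 + x2)⁻¹) * (1 + x2) ^ (2 * γ) := by gcongr
    _ = 2 * ((k ^ 2) ^ (2 * γ - 1) * x2) * ((1 + x2) ^ (2 * γ) * (1 + x2)⁻¹) := by ring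
    _ = 2 * (ε ^ (1 - 4 * γ) * ε) * (x2 ^ (2 * γ) * ((1 + x2) ^ (2 * γ) * (1 + x2)⁻¹)) := by rw [e2]; ring
    _ ≤ 2 * (ε ^ (1 - 4 * γ) * ε) * ((1 + x2) ^ (2 * γ) * ((1 + x2) ^ (2 * γ) * (1 + x2)⁻¹)) := by
        gcongr
    _ = _ := by rw [e4]

/-- Gaussian estimate, second supremum: if the covariance symbol `q` satisfies
`0 ≤ q(k) ≤ C₀` and `q(k) ≤ C₀/k²` for `k ≠ 0`, then for `T > 0` and `γ ∈ (0,1/10]` there is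
`C > 0` such that for all `ε ∈ (0,1)` and `|ν| ≤ 1`,
`sup_{S,R∈[0,T], S≠R} |S−R|^{−2γ} ∫_ℝ q(k) |f(S,k)−f(R,k)|² dk ≤ C (ε^{1−4γ} + ε^{1/5})`. -/
theorem stmt_17 (q : ℝ → ℝ) (C₀ : ℝ) (hC₀ : 0 < C₀) (hqm : Measurable q)
    (hq0 : ∀ k, 0 ≤ q k) (hqb : ∀ k, q k ≤ C₀) (hqd : ∀ k : ℝ, k ≠ 0 → q k ≤ C₀ / k ^ 2)
    (T : ℝ) (hT : 0 < T) (γ : ℝ) (hγ : γ ∈ Set.Ioc (0 : ℝ) (1 / 10)) :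
    ∃ C > (0 : ℝ), ∀ ε ∈ Set.Ioo (0 : ℝ) 1, ∀ ν : ℝ, |ν| ≤ 1 →
      (⨆ (S : ℝ) (_ : S ∈ Set.Icc (0 : ℝ) T) (R : ℝ) (_ : R ∈ Set.Icc (0 : ℝ) T)
          (_ : S ≠ R),
          ENNReal.ofReal (|S - R| ^ (-(2 * γ))) *
            ∫⁻ k : ℝ, ENNReal.ofReal (q k * (fker ε ν S k - fker ε ν R k) ^ 2)) ≤
        ENNReal.ofReal (C * (ε ^ (1 - 4 * γ) + ε ^ ((1 : ℝ) / 5))) := by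
  have hint : Integrable (fun y : ℝ => (1 + y ^ 2) ^ (4 * γ - 1)) := by
    have := integrable_rpow_neg_one_add_norm_sq (E := ℝ) (μ := volume) (r := 2 - 8 * γ)
      (by simp; linarith [hγ.2])
    refine this.congr (Filter.Eventually.of_forall fun y => ?_)
    simp only [Real.norm_eq_abs, sq_abs]
    congr 1; ring
  set I := ∫ y : ℝ, (1 + y ^ 2) ^ (4 * γ - 1) with hI
  have hI0 : 0 ≤ I := integral_nonneg fun y => by positivity
  set K := 2 * C₀ * (50 * Real.exp T) ^ 2 * 2 with hK
  have hK0 : 0 < K := by positivity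
  refine ⟨K * (I + 1), by positivity, ?_⟩
  intro ε hε ν hν
  have hε0 := hε.1
  refine iSup_le fun S => iSup_le fun hS => iSup_le fun R => iSup_le fun hR => iSup_le fun hSR => ?_
  have hd : 0 < |S - R| := abs_pos.2 (sub_ne_zero.2 hSR)
  set D := |S - R| ^ (2 * γ) with hD
  have hD0 : 0 < D := Real.rpow_pos_of_pos hd _
  have hεp := Real.rpow_pos_of_pos hε0 (1 - 4 * γ)
  have hpt : ∀ k, q k * (fker ε ν S k - fker ε ν R k) ^ 2 ≤
      D * K * (ε ^ (1 - 4 * γ) * ε) * (1 + (k * ε) ^ 2) ^ (4 * γ - 1) := by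
    intro k
    have hq : q k ≤ 2 * C₀ * (1 + k ^ 2)⁻¹ := by
      rw [← div_eq_mul_inv, le_div_iff₀ (by positivity)]
      have h1 := hqb k
      have h2 : q k * k ^ 2 ≤ C₀ := by
        rcases eq_or_ne k 0 with rfl | hk
        · simp; exact hC₀.le
        · exact (le_div_iff₀ (by positivity)).1 (hqd k hk)
      linarith
    calc _ ≤ (2 * C₀ * (1 + k ^ 2)⁻¹) * ((50 * Real.exp T) ^ 2 * (min 1 |k * ε|) ^ 2 *
          (((1 + k ^ 2) * (1 + (k * ε) ^ 2)) ^ (2 * γ) * D)) := by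
          gcongr
          exact aux_sq T ε ν S R k γ hε hν hS hR hγ
      _ = D * (2 * C₀ * (50 * Real.exp T) ^ 2) * ((1 + k ^ 2)⁻¹ * ((min 1 |k * ε|) ^ 2 * ((1 + k ^ 2) * (1 + (k * ε) ^ 2)) ^ (2 * γ))) := by ring
      _ ≤ D * (2 * C₀ * (50 * Real.exp T) ^ 2) * (2 * (ε ^ (1 - 4 * γ) * ε) * (1 + (k * ε) ^ 2) ^ (4 * γ - 1)) := by
          exact mul_le_mul_of_nonneg_left (aux_alg ε k γ hε hγ) (by positivity)
      _ = _ := by rw [hK]; ring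
  have hint2 : Integrable (fun k : ℝ => D * K * (ε ^ (1 - 4 * γ) * ε) * (1 + (k * ε) ^ 2) ^ (4 * γ - 1)) :=
    (hint.comp_mul_right' hε0.ne').const_mul _
  have hval : ∫ k : ℝ, D * K * (ε ^ (1 - 4 * γ) * ε) * (1 + (k * ε) ^ 2) ^ (4 * γ - 1) =
      D * (K * ε ^ (1 - 4 * γ) * I) := by
    rw [integral_const_mul, Measure.integral_comp_mul_right (fun y : ℝ => (1 + y ^ 2) ^ (4 * γ - 1)) ε,
      ← hI, abs_of_pos (inv_pos.2 hε0), smul_eq_mul]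
    field_simp
  have hlin : ∫⁻ k : ℝ, ENNReal.ofReal (q k * (fker ε ν S k - fker ε ν R k) ^ 2) ≤
      ENNReal.ofReal (D * (K * ε ^ (1 - 4 * γ) * I)) := by
    rw [← hval, ofReal_integral_eq_lintegral_ofReal hint2
      (Filter.Eventually.of_forall fun k => by positivity)]
    exact lintegral_mono fun k => ENNReal.ofReal_le_ofReal (hpt k)
  refine (mul_le_mul_right hlin _).trans ?_
  rw [← ENNReal.ofReal_mul (by positivity)]
  apply ENNReal.ofReal_le_ofReal
  rw [Real.rpow_neg hd.le, ← hD, ← mul_assoc, inv_mul_cancel₀ hD0.ne', one_mul]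
  have h5 : 0 ≤ ε ^ ((1 : ℝ) / 5) := by positivity
  calc K * ε ^ (1 - 4 * γ) * I = K * I * ε ^ (1 - 4 * γ) := by ring
    _ ≤ K * (I + 1) * (ε ^ (1 - 4 * γ) + ε ^ ((1 : ℝ) / 5)) := by
      gcongr
      · linarith
      · linarith
end

section
/- For every T > 0 and every γ ∈ (0, 1/4), there is a constant C > 0 such that for all ε ∈ (0,1) and all ν ∈ ℝ with |ν| ≤ 1, sup_{S ∈ (0,T]} S^{−2γ} ∫_0^S ∫_ℝ |f(τ,k)|² dk dτ ≤ C ε^{1−4γ}. -/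
open MeasureTheory Set

lemma aux_expdiff {a b y : ℝ} (ha : y ≤ a) (hb : y ≤ b) :
    (Real.exp (-a) - Real.exp (-b)) ^ 2 ≤ Real.exp (-y) ^ 2 * (a - b) ^ 2 := by
  have key : ∀ a b : ℝ, y ≤ a → a ≤ b →
      (Real.exp (-a) - Real.exp (-b)) ^ 2 ≤ Real.exp (-y) ^ 2 * (a - b) ^ 2 := by
    intro a b ha hab
    have h1 : Real.exp (-b) = Real.exp (-a) * Real.exp (a - b) := by
      rw [← Real.exp_add]; ring_nf
    have h2 := Real.add_one_le_exp (a - b)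
    have h3 : Real.exp (a - b) ≤ 1 := Real.exp_le_one_iff.2 (by linarith)
    have h4 : Real.exp (-a) ≤ Real.exp (-y) := Real.exp_le_exp.2 (by linarith)
    have h5 := Real.exp_pos (-a)
    have h6 : Real.exp (-a) * (b - a) ≤ Real.exp (-y) * (b - a) :=
      mul_le_mul_of_nonneg_right h4 (by linarith)
    rw [h1, ← neg_sub b a, neg_sq, ← mul_pow, neg_sub]
    apply pow_le_pow_left₀ <;> nlinarith
  rcases le_total a b with h | h
  · exact key a b ha h
  · have := key b a hb h
    nlinarith

lemma aux_min_s18 {x D y : ℝ} (hx : 1 < x) (hy : 0 ≤ y) (hD : |D| ≤ Real.exp (-y)) :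
    D ^ 2 ≤ 100 * (x / (1 + x)) * Real.exp (-y) := by
  have h1 : Real.exp (-y) ≤ 1 := Real.exp_le_one_iff.2 (by linarith)
  have h2 : D ^ 2 ≤ Real.exp (-y) ^ 2 := sq_le_sq.2 (by rwa [abs_of_pos (Real.exp_pos (-y))])
  have h3 : 1 / 2 ≤ x / (1 + x) := by
    rw [div_le_div_iff₀ (by norm_num) (by linarith)]; linarith
  have := Real.exp_pos (-y)
  nlinarith

lemma aux_pt_s18 {ε ν τ k T : ℝ} (hε : 0 < ε) (hν : |ν| ≤ 1) (hτ : 0 < τ) (hT : τ ≤ T) :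
    fker ε ν τ k ^ 2 ≤ 100 * Real.exp (2 * T) *
      (((ε * k) ^ 2 / (1 + (ε * k) ^ 2)) * Real.exp (-(k ^ 2 * τ))) := by
  have hE : Real.exp (τ * ν) ^ 2 ≤ Real.exp (2 * T) := by
    rw [← Real.exp_nat_mul]
    apply Real.exp_le_exp.2
    have := (abs_le.1 hν).2
    push_cast
    nlinarith
  obtain ⟨D, hfD, hD⟩ : ∃ D, fker ε ν τ k = Real.exp (τ * ν) * D ∧
      D ^ 2 ≤ 100 * ((ε * k) ^ 2 / (1 + (ε * k) ^ 2)) * Real.exp (-(k ^ 2 * τ)) := by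
    have hy : 0 ≤ k ^ 2 * τ := by positivity
    unfold fker
    split_ifs with h
    · refine ⟨_, rfl, ?_⟩
      have hs : -1 ≤ k * ε := by rwa [div_le_iff₀ hε] at h
      set y := k ^ 2 * τ with hyd
      have e1 : -τ * k ^ 2 * (2 + k * ε) ^ 2 = -(y * (2 + k * ε) ^ 2) := by rw [hyd]; ring
      have e2 : -4 * τ * k ^ 2 = -(4 * y) := by rw [hyd]; ring
      have b1 : y ≤ y * (2 + k * ε) ^ 2 := le_mul_of_one_le_right hy (by nlinarith)
      have b2 : y ≤ 4 * y := by linarith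
      rw [e1, e2]
      by_cases hx : 1 < (ε * k) ^ 2
      · apply aux_min_s18 hx hy
        have c1 : Real.exp (-(y * (2 + k * ε) ^ 2)) ≤ Real.exp (-y) :=
          Real.exp_le_exp.2 (by linarith)
        have c2 : Real.exp (-(4 * y)) ≤ Real.exp (-y) := Real.exp_le_exp.2 (by linarith)
        have := Real.exp_pos (-(4 * y))
        have := Real.exp_pos (-(y * (2 + k * ε) ^ 2))
        rw [abs_le]; constructor <;> linarith
      · push Not at hx
        refine (aux_expdiff b1 b2).trans ?_
        have hs2 : k * ε ≤ 1 := by nlinarith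
        set x := (ε * k) ^ 2 with hxd
        have hx0 : 0 ≤ x := by positivity
        have d1 : (y * (2 + k * ε) ^ 2 - 4 * y) ^ 2 ≤ 25 * x * y ^ 2 := by
          have : (y * (2 + k * ε) ^ 2 - 4 * y) ^ 2 = (4 + k * ε) ^ 2 * (x * y ^ 2) := by
            rw [hxd]; ring
          rw [this, mul_assoc]
          apply mul_le_mul_of_nonneg_right _ (by positivity)
          nlinarith
        have d2 : y ^ 2 * Real.exp (-y) ≤ 2 := by
          have := Real.quadratic_le_exp_of_nonneg hy
          rw [Real.exp_neg, ← div_eq_mul_inv, div_le_iff₀ (Real.exp_pos y)]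
          nlinarith
        have d3 : x / 2 ≤ x / (1 + x) := by
          apply div_le_div_of_nonneg_left hx0 <;> linarith
        have d4 := Real.exp_pos (-y)
        calc Real.exp (-y) ^ 2 * (y * (2 + k * ε) ^ 2 - 4 * y) ^ 2
            ≤ Real.exp (-y) ^ 2 * (25 * x * y ^ 2) := by gcongr
          _ = 25 * x * Real.exp (-y) * (y ^ 2 * Real.exp (-y)) := by ring
          _ ≤ 25 * x * Real.exp (-y) * 2 := by gcongr
          _ = 100 * (x / 2) * Real.exp (-y) := by ring
          _ ≤ _ := by gcongr
    · refine ⟨-Real.exp (-4 * τ * k ^ 2), by ring, ?_⟩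
      push Not at h
      have hs : k * ε < -1 := by rwa [lt_div_iff₀ hε] at h
      apply aux_min_s18 (by nlinarith) hy
      rw [abs_neg, abs_of_pos (Real.exp_pos _)]
      exact Real.exp_le_exp.2 (by nlinarith)
  rw [hfD, mul_pow]
  calc _ ≤ Real.exp (2 * T) * (100 * ((ε * k) ^ 2 / (1 + (ε * k) ^ 2)) *
        Real.exp (-(k ^ 2 * τ))) := by gcongr
    _ = _ := by ring

lemma aux_tau {p r : ℝ} (hp : 0 < p) (hr : 0 < r) :
    ∫⁻ τ in Ioi (0 : ℝ), ENNReal.ofReal (τ ^ (p - 1) * Real.exp (-(r * τ))) =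
      ENNReal.ofReal ((1 / r) ^ p * Real.Gamma p) := by
  have h := Real.integral_rpow_mul_exp_neg_mul_Ioi hp hr
  have hpos : 0 < (1 / r) ^ p * Real.Gamma p :=
    mul_pos (Real.rpow_pos_of_pos (by positivity) _) (Real.Gamma_pos_of_pos hp)
  rw [← h, ofReal_integral_eq_lintegral_ofReal]
  · by_contra hc
    have := integral_undef hc
    rw [this] at h
    linarith
  · filter_upwards [ae_restrict_mem measurableSet_Ioi] with t ht
    have : (0 : ℝ) < t := ht
    simp only [Pi.zero_apply]
    positivity

lemma aux_k {p ε k : ℝ} (hp : 0 < p) (hp1 : p < 1) (hε : 0 < ε) (hk : k ≠ 0) :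
    ((ε * k) ^ 2 / (1 + (ε * k) ^ 2)) * (1 / k ^ 2) ^ p ≤
      ε ^ (2 * p) * (1 + ‖ε * k‖ ^ 2) ^ (-(2 * p) / 2) := by
  have hk2 : 0 < k ^ 2 := by positivity
  have hx : 0 < (ε * k) ^ 2 := by positivity
  have e1 : (1 / k ^ 2) ^ p = ε ^ (2 * p) * ((ε * k) ^ 2) ^ (-p) := by
    rw [mul_pow, Real.mul_rpow (by positivity) (by positivity), ← mul_assoc,
      ← Real.rpow_natCast ε 2, ← Real.rpow_mul hε.le, ← Real.rpow_add hε, one_div,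
      Real.inv_rpow hk2.le, Real.rpow_neg hk2.le]
    push_cast
    ring_nf
    simp
  rw [e1, Real.norm_eq_abs, sq_abs]
  set x := (ε * k) ^ 2
  have e2 : x * x ^ (-p) = x ^ (1 - p) := by
    rw [sub_eq_add_neg, Real.rpow_add hx, Real.rpow_one]
  have e3 : (1 + x) ^ (-(2 * p) / 2) = (1 + x) ^ (1 - p) / (1 + x) := by
    rw [show -(2 * p) / 2 = (1 - p) - 1 by ring, Real.rpow_sub_one (by positivity)]
  rw [e3]
  calc _ = ε ^ (2 * p) * (x * x ^ (-p) / (1 + x)) := by ring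
    _ ≤ _ := by
      rw [e2]
      have : x ^ (1 - p) ≤ (1 + x) ^ (1 - p) :=
        Real.rpow_le_rpow hx.le (by linarith) (by linarith)
      gcongr

/-- Morrey-type term of the `𝒦_γ`-norm: for every `T > 0` and `γ ∈ (0,1/4)` there is `C > 0`
such that for all `ε ∈ (0,1)` and `|ν| ≤ 1`,
`sup_{S∈(0,T]} S^{−2γ} ∫_0^S ∫_ℝ |f(τ,k)|² dk dτ ≤ C ε^{1−4γ}`. -/
theorem stmt_18 (T : ℝ) (hT : 0 < T) (γ : ℝ) (hγ : γ ∈ Set.Ioo (0 : ℝ) (1 / 4)) :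
    ∃ C > (0 : ℝ), ∀ ε ∈ Set.Ioo (0 : ℝ) 1, ∀ ν : ℝ, |ν| ≤ 1 →
      (⨆ (S : ℝ) (_ : S ∈ Set.Ioc (0 : ℝ) T),
          ENNReal.ofReal (S ^ (-(2 * γ))) *
            ∫⁻ τ in Set.Ioc (0 : ℝ) S, ∫⁻ k : ℝ, ENNReal.ofReal (fker ε ν τ k ^ 2)) ≤
        ENNReal.ofReal (C * ε ^ (1 - 4 * γ)) := by
  obtain ⟨hγ0, hγ1⟩ := hγ
  obtain ⟨p, hp⟩ : ∃ p, p = 1 - 2 * γ := ⟨_, rfl⟩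
  have hp0 : 1 / 2 < p := by linarith
  have hp1 : p < 1 := by linarith
  have hg : Integrable (fun u : ℝ => (1 + ‖u‖ ^ 2) ^ (-(2 * p) / 2)) volume :=
    integrable_rpow_neg_one_add_norm_sq (by simp; linarith)
  have hM : 0 ≤ ∫ u : ℝ, (1 + ‖u‖ ^ 2) ^ (-(2 * p) / 2) :=
    integral_nonneg fun u => by positivity
  set M := ∫ u : ℝ, (1 + ‖u‖ ^ 2) ^ (-(2 * p) / 2) with hMd
  have hG : 0 < Real.Gamma p := Real.Gamma_pos_of_pos (by linarith)
  set K := 100 * Real.exp (2 * T) with hK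
  have hK0 : 0 < K := by positivity
  refine ⟨K * Real.Gamma p * (M + 1), by positivity, ?_⟩
  rintro ε ⟨hε, -⟩ ν hν
  refine iSup₂_le fun S hS => ?_
  obtain ⟨hS0, hST⟩ := hS
  set w : ℝ → ℝ := fun k => K * ((ε * k) ^ 2 / (1 + (ε * k) ^ 2)) with hw
  have hw0 : ∀ k, 0 ≤ w k := fun k => by simp only [hw]; positivity
  calc ENNReal.ofReal (S ^ (-(2 * γ))) *
          ∫⁻ τ in Ioc (0 : ℝ) S, ∫⁻ k : ℝ, ENNReal.ofReal (fker ε ν τ k ^ 2)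
      = ∫⁻ τ in Ioc (0 : ℝ) S, ENNReal.ofReal (S ^ (-(2 * γ))) *
          ∫⁻ k : ℝ, ENNReal.ofReal (fker ε ν τ k ^ 2) :=
        (lintegral_const_mul' _ _ ENNReal.ofReal_ne_top).symm
    _ ≤ ∫⁻ τ in Ioc (0 : ℝ) S, ∫⁻ k : ℝ,
          ENNReal.ofReal (w k * (τ ^ (p - 1) * Real.exp (-(k ^ 2 * τ)))) := by
        refine setLIntegral_mono' measurableSet_Ioc fun τ hτ => ?_
        rw [← lintegral_const_mul' _ _ ENNReal.ofReal_ne_top]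
        refine lintegral_mono fun k => ?_
        rw [← ENNReal.ofReal_mul (by positivity)]
        apply ENNReal.ofReal_le_ofReal
        have h1 := aux_pt_s18 (k := k) hε hν hτ.1 (hτ.2.trans hST)
        have h2 : S ^ (-(2 * γ)) ≤ τ ^ (-(2 * γ)) :=
          Real.rpow_le_rpow_of_nonpos hτ.1 hτ.2 (by linarith)
        have h3 : p - 1 = -(2 * γ) := by linarith
        have h4 : 0 ≤ τ ^ (-(2 * γ)) := Real.rpow_nonneg hτ.1.le _
        rw [h3]
        calc _ ≤ τ ^ (-(2 * γ)) * (100 * Real.exp (2 * T) *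
              (((ε * k) ^ 2 / (1 + (ε * k) ^ 2)) * Real.exp (-(k ^ 2 * τ)))) := by gcongr
          _ = _ := by simp only [hw, hK]; ring
    _ ≤ ∫⁻ τ in Ioi (0 : ℝ), ∫⁻ k : ℝ,
          ENNReal.ofReal (w k * (τ ^ (p - 1) * Real.exp (-(k ^ 2 * τ)))) :=
        lintegral_mono_set Ioc_subset_Ioi_self
    _ = ∫⁻ k : ℝ, ∫⁻ τ in Ioi (0 : ℝ),
          ENNReal.ofReal (w k * (τ ^ (p - 1) * Real.exp (-(k ^ 2 * τ)))) := by
        apply lintegral_lintegral_swap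
        apply Measurable.aemeasurable
        simp only [hw, Function.uncurry_def]
        fun_prop
    _ ≤ ∫⁻ k : ℝ, ENNReal.ofReal (K * Real.Gamma p * ε ^ (2 * p) *
          (1 + ‖ε * k‖ ^ 2) ^ (-(2 * p) / 2)) := by
        refine lintegral_mono_ae ?_
        filter_upwards [Measure.ae_ne volume (0 : ℝ)] with k hk
        simp_rw [ENNReal.ofReal_mul (hw0 k)]
        rw [lintegral_const_mul' _ _ ENNReal.ofReal_ne_top,
          aux_tau (by linarith) (by positivity : 0 < k ^ 2), ← ENNReal.ofReal_mul (hw0 k)]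
        apply ENNReal.ofReal_le_ofReal
        have := aux_k (by linarith : 0 < p) hp1 hε hk
        calc _ = K * Real.Gamma p *
              (((ε * k) ^ 2 / (1 + (ε * k) ^ 2)) * (1 / k ^ 2) ^ p) := by
              simp only [hw]; ring
          _ ≤ K * Real.Gamma p * (ε ^ (2 * p) * (1 + ‖ε * k‖ ^ 2) ^ (-(2 * p) / 2)) := by
              gcongr
          _ = _ := by ring
    _ = ENNReal.ofReal (K * Real.Gamma p * ε ^ (2 * p) * (ε⁻¹ * M)) := by
        rw [← ofReal_integral_eq_lintegral_ofReal]
        · rw [integral_const_mul,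
            Measure.integral_comp_mul_left (fun u : ℝ => (1 + ‖u‖ ^ 2) ^ (-(2 * p) / 2)) ε,
            abs_of_pos (by positivity), smul_eq_mul]
        · exact (hg.comp_mul_left' hε.ne').const_mul _
        · exact Filter.Eventually.of_forall fun k => by
            simp only [Pi.zero_apply]; positivity
    _ ≤ _ := by
        apply ENNReal.ofReal_le_ofReal
        have : ε ^ (1 - 4 * γ) = ε ^ (2 * p) * ε⁻¹ := by
          rw [← Real.rpow_neg_one, ← Real.rpow_add hε]; congr 1; rw [hp]; ring
        rw [this]
        have h0 : 0 ≤ K * Real.Gamma p * (ε ^ (2 * p) * ε⁻¹) := by positivity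
        nlinarith
end

section
/- For every T > 0, every κ > 0, and every γ ∈ (0, 1/10) with 10γ + κ < 1, there is a constant C > 0 such that for all ε ∈ (0,1) and all ν ∈ ℝ with |ν| ≤ 1, sup_{0 ≤ R < S ≤ T} (S − R)^{−2γ} ∫_0^R ∫_ℝ |f(S−R+τ, k) − f(τ, k)|² dk dτ ≤ C ε^{1 − 10γ − κ}. -/
open MeasureTheory Set

lemma aux_min_s19 {y γ : ℝ} (hy : 0 ≤ y) (h0 : 0 < γ) (h1 : γ < 1) : min 1 y ≤ y ^ γ := by
  rcases le_total 1 y with h | h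
  · exact (min_le_left _ _).trans (Real.one_le_rpow h h0.le)
  · refine (min_le_right _ _).trans ?_
    rcases hy.eq_or_lt with h' | h'
    · rw [← h', Real.zero_rpow h0.ne']
    · calc y = y ^ (1:ℝ) := (Real.rpow_one y).symm
        _ ≤ y ^ γ := Real.rpow_le_rpow_of_exponent_ge h' h h1.le

lemma aux_exp_sub {x y m : ℝ} (hx : x ≤ m) (hy : y ≤ m) :
    |Real.exp x - Real.exp y| ≤ |x - y| * Real.exp m := by
  wlog h : y ≤ x generalizing x y
  · rw [abs_sub_comm, abs_sub_comm x y]; exact this hy hx (le_of_not_ge h)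
  rw [abs_of_nonneg (sub_nonneg.2 (Real.exp_le_exp.2 h)), abs_of_nonneg (sub_nonneg.2 h)]
  have h1 : Real.exp y = Real.exp x * Real.exp (y - x) := by rw [← Real.exp_add]; ring_nf
  have h2 := Real.add_one_le_exp (y - x)
  have h3 := Real.exp_le_exp.2 hx
  have h4 := Real.exp_pos x
  calc Real.exp x - Real.exp y ≤ (x - y) * Real.exp x := by rw [h1]; nlinarith
    _ ≤ _ := mul_le_mul_of_nonneg_left h3 (sub_nonneg.2 h)

lemma aux_hol {T h ν a γ : ℝ} (h0 : 0 < h) (hT : h ≤ T) (hν : |ν| ≤ 1) (ha : 0 ≤ a)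
    (g0 : 0 < γ) (g1 : γ < 1) :
    |Real.exp (h * (ν - a)) - 1| ≤ Real.exp T * (h ^ γ * (1 + a) ^ γ) := by
  obtain ⟨n1, n2⟩ := abs_le.1 hν
  have hz : h * (ν - a) ≤ T := by nlinarith
  have hTp : 0 ≤ T := h0.le.trans hT
  have e1 : |Real.exp (h * (ν - a)) - 1| ≤ Real.exp T := by
    rw [abs_le]
    have := Real.exp_pos (h * (ν - a))
    have := Real.exp_le_exp.2 hz
    have := Real.one_le_exp hTp
    constructor <;> linarith
  have e2 : |Real.exp (h * (ν - a)) - 1| ≤ h * (1 + a) * Real.exp T := by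
    have := aux_exp_sub hz hTp
    rw [Real.exp_zero, sub_zero, abs_mul, abs_of_pos h0] at this
    refine this.trans ?_
    gcongr
    rw [abs_le]; constructor <;> linarith
  rw [← Real.mul_rpow h0.le (by linarith)]
  have := aux_min_s19 (y := h * (1 + a)) (by positivity) g0 g1
  have hm : |Real.exp (h * (ν - a)) - 1| ≤ Real.exp T * min 1 (h * (1 + a)) := by
    rcases min_choice 1 (h * (1 + a)) with h | h <;> rw [h] <;> linarith
  exact hm.trans (mul_le_mul_of_nonneg_left this (Real.exp_pos _).le)

lemma aux_dec {T t ν a q : ℝ} (h0 : 0 < t) (hT : t ≤ T) (hν : |ν| ≤ 1) (ha : q ≤ a) :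
    t * (ν - a) ≤ T + -(q * t) := by
  obtain ⟨n1, n2⟩ := abs_le.1 hν
  nlinarith

lemma aux_diff {T t ν a b q : ℝ} (h0 : 0 < t) (hT : t ≤ T) (hν : |ν| ≤ 1) (ha : q ≤ a)
    (hb : q ≤ b) :
    |Real.exp (t * (ν - a)) - Real.exp (t * (ν - b))| ≤
      t * |a - b| * (Real.exp T * Real.exp (-(q * t))) := by
  have := aux_exp_sub (aux_dec h0 hT hν ha) (aux_dec h0 hT hν hb)
  rw [Real.exp_add] at this
  refine this.trans (le_of_eq ?_)
  have : t * (ν - a) - t * (ν - b) = t * (b - a) := by ring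
  rw [this, abs_mul, abs_of_pos h0, abs_sub_comm]

lemma aux_xe {x : ℝ} : x * Real.exp (-x) ≤ 2 * Real.exp (-(x / 2)) := by
  have h : Real.exp (-x) = Real.exp (-(x/2)) * Real.exp (-(x/2)) := by
    rw [← Real.exp_add]; ring_nf
  have h2 := Real.add_one_le_exp (x/2)
  have h3 : Real.exp (x/2) * Real.exp (-(x/2)) = 1 := by rw [← Real.exp_add]; simp
  have h4 := Real.exp_pos (-(x/2))
  rw [h]
  have : x / 2 * Real.exp (-(x/2)) ≤ 1 := by nlinarith
  nlinarith

lemma aux_xe2 {x γ : ℝ} (hx : 0 ≤ x) (g0 : 0 < γ) (g1 : γ < 1) : x * Real.exp (-x) ≤ x ^ γ := by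
  refine le_trans (le_min ?_ ?_) (aux_min_s19 hx g0 g1)
  · have h2 := Real.add_one_le_exp x
    have h3 : Real.exp x * Real.exp (-x) = 1 := by rw [← Real.exp_add]; simp
    have h4 := Real.exp_pos (-x)
    nlinarith
  · have : Real.exp (-x) ≤ 1 := Real.exp_le_one_iff.2 (by linarith)
    nlinarith

lemma aux_one {T h τ ν a q M γ : ℝ} (h0 : 0 < h) (hT : h ≤ T) (t0 : 0 < τ) (tT : τ ≤ T)
    (hν : |ν| ≤ 1) (ha : q ≤ a) (hq : 0 ≤ q) (haM : 1 + a ≤ M) (g0 : 0 < γ) (g1 : γ < 1) :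
    |Real.exp (τ * (ν - a)) * (Real.exp (h * (ν - a)) - 1)| ≤
      Real.exp T ^ 2 * (h ^ γ * M ^ γ * Real.exp (-(q * τ / 2))) := by
  rw [abs_mul, abs_of_pos (Real.exp_pos _)]
  have e1 := Real.exp_le_exp.2 (aux_dec t0 tT hν ha)
  rw [Real.exp_add] at e1
  have e2 := aux_hol h0 hT hν (hq.trans ha) g0 g1
  have e3 : (1 + a) ^ γ ≤ M ^ γ := Real.rpow_le_rpow (by linarith) haM g0.le
  have e4 : Real.exp (-(q * τ)) ≤ Real.exp (-(q * τ / 2)) :=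
    Real.exp_le_exp.2 (by nlinarith [mul_nonneg hq t0.le])
  calc _ ≤ (Real.exp T * Real.exp (-(q * τ / 2))) * (Real.exp T * (h ^ γ * M ^ γ)) := by
        refine mul_le_mul (e1.trans (by gcongr)) (e2.trans (by gcongr)) (abs_nonneg _) (by positivity)
    _ = _ := by ring

lemma fker_ge {ε ν τ k : ℝ} (hk : -1 / ε ≤ k) : fker ε ν τ k =
    Real.exp (τ * (ν - k ^ 2 * (2 + k * ε) ^ 2)) - Real.exp (τ * (ν - 4 * k ^ 2)) := by
  rw [fker, if_pos hk, mul_sub, ← Real.exp_add, ← Real.exp_add]; ring_nf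

lemma fker_lt {ε ν τ k : ℝ} (hk : ¬ -1 / ε ≤ k) : fker ε ν τ k =
    - Real.exp (τ * (ν - 4 * k ^ 2)) := by
  rw [fker, if_neg hk, ← Real.exp_add]; ring_nf

lemma aux_split (h τ c : ℝ) : Real.exp ((h + τ) * c) = Real.exp (τ * c) * Real.exp (h * c) := by
  rw [← Real.exp_add]; ring_nf

lemma bound_mid {T h τ ν ε k γ : ℝ} (h0 : 0 < h) (hT : h ≤ T) (t0 : 0 < τ) (tT : τ ≤ T)
    (hν : |ν| ≤ 1) (g0 : 0 < γ) (g1 : γ < 1) (e0 : 0 < ε) (e1 : ε < 1) (hk : |k * ε| ≤ 1) :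
    |fker ε ν (h + τ) k - fker ε ν τ k| ≤
      15 * Real.exp T ^ 2 * (h ^ γ * (10 / ε ^ 2) ^ γ * Real.exp (-(k ^ 2 * τ / 2))) * (ε * |k|) := by
  obtain ⟨k1, k2⟩ := abs_le.1 hk
  have hk' : -1 / ε ≤ k := by rw [div_le_iff₀ e0]; exact k1
  set a := k ^ 2 * (2 + k * ε) ^ 2 with ha
  have hqa : k ^ 2 ≤ a := by
    have : 1 ≤ (2 + k * ε) ^ 2 := by nlinarith
    nlinarith [sq_nonneg k]
  have hqb : k ^ 2 ≤ 4 * k ^ 2 := by nlinarith [sq_nonneg k]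
  have hkk : k ^ 2 ≤ 1 / ε ^ 2 := by
    rw [le_div_iff₀ (by positivity), ← mul_pow]; exact (sq_le_one_iff_abs_le_one _).2 hk
  have h1e : 1 ≤ 1 / ε ^ 2 := by
    rw [le_div_iff₀ (by positivity)]; nlinarith
  have h10 : 10 / ε ^ 2 = 10 * (1 / ε ^ 2) := by ring
  have haM : 1 + a ≤ 10 / ε ^ 2 := by
    have : (2 + k * ε) ^ 2 ≤ 9 := by nlinarith
    rw [h10]; nlinarith [sq_nonneg k]
  have hab : |a - 4 * k ^ 2| ≤ 5 * (ε * |k|) * k ^ 2 := by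
    have : a - 4 * k ^ 2 = k ^ 2 * ((k * ε) * (4 + k * ε)) := by rw [ha]; ring
    rw [this, abs_mul, abs_mul, abs_of_nonneg (sq_nonneg k), abs_of_nonneg (by linarith : 0 ≤ 4 + k * ε),
      abs_mul, abs_of_pos e0]
    have : |k| * ε * (4 + k * ε) ≤ |k| * ε * 5 := by gcongr; linarith
    nlinarith [sq_nonneg k]
  rw [fker_ge hk', fker_ge hk', ← ha, aux_split, aux_split]
  have hid : Real.exp (τ * (ν - a)) * Real.exp (h * (ν - a)) -
      Real.exp (τ * (ν - 4 * k ^ 2)) * Real.exp (h * (ν - 4 * k ^ 2)) -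
      (Real.exp (τ * (ν - a)) - Real.exp (τ * (ν - 4 * k ^ 2))) =
      (Real.exp (τ * (ν - a)) - Real.exp (τ * (ν - 4 * k ^ 2))) * (Real.exp (h * (ν - a)) - 1) +
      Real.exp (τ * (ν - 4 * k ^ 2)) *
        (Real.exp (h * (ν - a)) - Real.exp (h * (ν - 4 * k ^ 2))) := by ring
  rw [hid]
  refine (abs_add_le _ _).trans ?_
  rw [abs_mul, abs_mul, abs_of_pos (Real.exp_pos (τ * (ν - 4 * k ^ 2)))]
  have A1 := aux_diff t0 tT hν hqa hqb
  have A2 := aux_hol h0 hT hν ((sq_nonneg k).trans hqa) g0 g1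
  have A3 : (1 + a) ^ γ ≤ (10 / ε ^ 2) ^ γ := 
    Real.rpow_le_rpow (by linarith [sq_nonneg k]) haM g0.le
  have B1 := Real.exp_le_exp.2 (aux_dec t0 tT hν hqb)
  rw [Real.exp_add] at B1
  have B2 := aux_diff h0 hT hν hqa hqb
  have B3 : Real.exp (-(k ^ 2 * τ)) ≤ Real.exp (-(k ^ 2 * τ / 2)) :=
    Real.exp_le_exp.2 (by nlinarith [mul_nonneg (sq_nonneg k) t0.le])
  have A1' : |Real.exp (τ * (ν - a)) - Real.exp (τ * (ν - 4 * k ^ 2))| ≤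
      10 * Real.exp T * (ε * |k|) * Real.exp (-(k ^ 2 * τ / 2)) := by
    refine A1.trans ?_
    calc _ ≤ τ * (5 * (ε * |k|) * k ^ 2) * (Real.exp T * Real.exp (-(k ^ 2 * τ))) := by gcongr
      _ = 5 * Real.exp T * (ε * |k|) * ((k ^ 2 * τ) * Real.exp (-(k ^ 2 * τ))) := by ring
      _ ≤ 5 * Real.exp T * (ε * |k|) * (2 * Real.exp (-(k ^ 2 * τ / 2))) := by
        exact mul_le_mul_of_nonneg_left aux_xe (by positivity)
      _ = _ := by ring
  have B2' : |Real.exp (h * (ν - a)) - Real.exp (h * (ν - 4 * k ^ 2))| ≤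
      5 * Real.exp T * (ε * |k|) * (h ^ γ * (10 / ε ^ 2) ^ γ) := by
    refine B2.trans ?_
    calc _ ≤ h * (5 * (ε * |k|) * k ^ 2) * (Real.exp T * Real.exp (-(k ^ 2 * h))) := by gcongr
      _ = 5 * Real.exp T * (ε * |k|) * ((k ^ 2 * h) * Real.exp (-(k ^ 2 * h))) := by ring
      _ ≤ 5 * Real.exp T * (ε * |k|) * (h * (10 / ε ^ 2)) ^ γ := by
        gcongr
        refine (aux_xe2 (by positivity) g0 g1).trans ?_
        refine Real.rpow_le_rpow (by positivity) ?_ g0.le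
        rw [mul_comm]
        gcongr
        linarith
      _ = _ := by rw [Real.mul_rpow h0.le (by positivity)]
  calc _ ≤ (10 * Real.exp T * (ε * |k|) * Real.exp (-(k ^ 2 * τ / 2))) *
          (Real.exp T * (h ^ γ * (10 / ε ^ 2) ^ γ)) +
        (Real.exp T * Real.exp (-(k ^ 2 * τ / 2))) *
          (5 * Real.exp T * (ε * |k|) * (h ^ γ * (10 / ε ^ 2) ^ γ)) := by
        refine add_le_add (mul_le_mul A1' (A2.trans (by gcongr)) (abs_nonneg _) (by positivity))
          (mul_le_mul (B1.trans (by gcongr)) B2' (abs_nonneg _) (by positivity))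
    _ = _ := by ring

lemma bound_out {T h τ ν ε k γ : ℝ} (h0 : 0 < h) (hT : h ≤ T) (t0 : 0 < τ) (tT : τ ≤ T)
    (hν : |ν| ≤ 1) (g0 : 0 < γ) (g1 : γ < 1) (e0 : 0 < ε) (e1 : ε < 1) (hk : 1 < |k * ε|) :
    |fker ε ν (h + τ) k - fker ε ν τ k| ≤
      2 * Real.exp T ^ 2 * (h ^ γ * (10 * k ^ 4) ^ γ * Real.exp (-(k ^ 2 * τ / 2))) := by
  have hk1 : 1 ≤ k ^ 2 := by
    have h1 : 1 < (k * ε) ^ 2 := (one_lt_sq_iff_one_lt_abs _).2 hk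
    have h2 : ε ^ 2 ≤ 1 := by nlinarith
    nlinarith [sq_nonneg k, mul_pow k ε 2]
  have hk4 : k ^ 4 = k ^ 2 * k ^ 2 := by ring
  have hqb : k ^ 2 ≤ 4 * k ^ 2 := by nlinarith [sq_nonneg k]
  have O := aux_one (M := 10 * k ^ 4) h0 hT t0 tT hν hqb (sq_nonneg k)
    (by rw [hk4]; nlinarith) g0 g1
  by_cases hk' : -1 / ε ≤ k
  · have hk2 : 1 < k * ε := by
      rw [div_le_iff₀ e0] at hk'
      rcases lt_abs.1 hk with h | h <;> linarith
    have hqa : k ^ 2 ≤ k ^ 2 * (2 + k * ε) ^ 2 := by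
      have : 1 ≤ (2 + k * ε) ^ 2 := by nlinarith
      nlinarith [sq_nonneg k]
    have haM : 1 + k ^ 2 * (2 + k * ε) ^ 2 ≤ 10 * k ^ 4 := by
      have h1 : (2 + k * ε) ^ 2 ≤ 9 * (k * ε) ^ 2 := by nlinarith
      have h2 : (k * ε) ^ 2 ≤ k ^ 2 := by
        rw [mul_pow]; have : ε ^ 2 ≤ 1 := by nlinarith
        nlinarith
      rw [hk4]; nlinarith
    have O' := aux_one (M := 10 * k ^ 4) h0 hT t0 tT hν hqa (sq_nonneg k) haM g0 g1
    rw [fker_ge hk', fker_ge hk', aux_split, aux_split]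
    have := (abs_sub _ _).trans (add_le_add O' O)
    refine le_trans (le_of_eq ?_) (this.trans (le_of_eq ?_))
    · congr 1; ring
    · ring
  · rw [fker_lt hk', fker_lt hk', aux_split]
    rw [← abs_neg] at O
    have hp : 0 ≤ Real.exp T ^ 2 * (h ^ γ * (10 * k ^ 4) ^ γ * Real.exp (-(k ^ 2 * τ / 2))) := by
      positivity
    calc _ ≤ _ := le_trans (le_of_eq (by congr 1; ring)) O
      _ ≤ _ := by linarith

noncomputable def wgt (ε γ k : ℝ) : ℝ :=
  if |k * ε| ≤ 1 then ε ^ (2 - 4 * γ) else |k| ^ (8 * γ - 2)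

lemma bound_all {T h τ ν ε k γ : ℝ} (h0 : 0 < h) (hT : h ≤ T) (t0 : 0 < τ) (tT : τ ≤ T)
    (hν : |ν| ≤ 1) (g0 : 0 < γ) (g1 : γ < 1) (e0 : 0 < ε) (e1 : ε < 1) :
    (fker ε ν (h + τ) k - fker ε ν τ k) ^ 2 ≤
      (150 * Real.exp T ^ 2) ^ 2 * h ^ (2 * γ) * (wgt ε γ k * (k ^ 2 * Real.exp (-(k ^ 2 * τ)))) := by
  have hsq : ∀ x : ℝ, 0 ≤ x → x ^ (2 * γ) = (x ^ γ) ^ 2 := fun x hx => by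
    rw [mul_comm, Real.rpow_mul hx]; norm_num
  have he : Real.exp (-(k ^ 2 * τ)) = Real.exp (-(k ^ 2 * τ / 2)) ^ 2 := by
    rw [← Real.exp_nat_mul]; congr 1; push_cast; ring
  have h10 : (10:ℝ) ^ γ ≤ 10 := by
    calc (10:ℝ) ^ γ ≤ 10 ^ (1:ℝ) := Real.rpow_le_rpow_of_exponent_le (by norm_num) g1.le
      _ = 10 := Real.rpow_one _
  have h10' : (0:ℝ) ≤ (10:ℝ) ^ γ := by positivity
  rw [hsq h h0.le, he, ← sq_abs (_ - _), wgt]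
  split_ifs with hk
  · have := bound_mid h0 hT t0 tT hν g0 g1 e0 e1 hk
    have hE : ε ^ (2 - 4 * γ) = ε ^ 2 * ((1 / ε ^ 2) ^ γ) ^ 2 := by
      rw [Real.rpow_sub e0, one_div, Real.inv_rpow (by positivity), ← Real.rpow_natCast ε 2,
        ← Real.rpow_mul e0.le, inv_pow, ← Real.rpow_natCast _ 2, ← Real.rpow_mul e0.le, div_eq_mul_inv]
      norm_num
      ring_nf
      simp
    calc _ ≤ _ := pow_le_pow_left₀ (abs_nonneg _) this 2
      _ = (15 * 10 ^ γ * Real.exp T ^ 2) ^ 2 * (h ^ γ) ^ 2 *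
          (ε ^ (2 - 4 * γ) * (k ^ 2 * Real.exp (-(k ^ 2 * τ / 2)) ^ 2)) := by
        rw [hE, ← sq_abs k, show 10 / ε ^ 2 = 10 * (1 / ε ^ 2) by ring,
          Real.mul_rpow (by norm_num) (by positivity)]
        ring
      _ ≤ _ := by gcongr; linarith
  · push Not at hk
    have := bound_out h0 hT t0 tT hν g0 g1 e0 e1 hk
    have hk0 : 0 < |k| := by
      rcases (abs_nonneg k).eq_or_lt with h | h
      · rw [abs_mul, ← h] at hk; norm_num at hk
      · exact h
    have hE : |k| ^ (8 * γ - 2) * k ^ 2 = ((k ^ 4) ^ γ) ^ 2 := by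
      rw [← sq_abs k, show k ^ 4 = |k| ^ 4 by rw [← abs_pow]; exact (abs_of_nonneg (by positivity)).symm]
      rw [← Real.rpow_natCast |k| 2, ← Real.rpow_natCast |k| 4, ← Real.rpow_natCast _ 2, ← Real.rpow_mul hk0.le,
        ← Real.rpow_mul hk0.le, ← Real.rpow_add hk0]
      congr 1; push_cast; ring
    calc _ ≤ _ := pow_le_pow_left₀ (abs_nonneg _) this 2
      _ = (2 * 10 ^ γ * Real.exp T ^ 2) ^ 2 * (h ^ γ) ^ 2 *
          (|k| ^ (8 * γ - 2) * k ^ 2 * Real.exp (-(k ^ 2 * τ / 2)) ^ 2) := by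
        rw [hE, Real.mul_rpow (by norm_num) (by positivity)]
        ring
      _ ≤ (150 * Real.exp T ^ 2) ^ 2 * (h ^ γ) ^ 2 *
          (|k| ^ (8 * γ - 2) * k ^ 2 * Real.exp (-(k ^ 2 * τ / 2)) ^ 2) := by gcongr; linarith
      _ = _ := by ring

lemma wgt_nonneg {ε γ k : ℝ} (e0 : 0 < ε) : 0 ≤ wgt ε γ k := by
  rw [wgt]; split_ifs <;> positivity

lemma wgt_meas (ε γ : ℝ) : Measurable (wgt ε γ) := by
  unfold wgt
  refine Measurable.ite (measurableSet_le (by fun_prop) (by fun_prop)) (by fun_prop) (by fun_prop)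

lemma exp_int {q R : ℝ} (hq : 0 ≤ q) :
    ∫⁻ τ in Ioc (0:ℝ) R, ENNReal.ofReal (q * Real.exp (-(q * τ))) ≤ 1 := by
  rcases hq.eq_or_lt with h | h
  · simp [← h]
  have hi := (integrableOn_exp_mul_Ioi (a := -q) (by linarith) 0)
  calc _ ≤ ∫⁻ τ in Ioi (0:ℝ), ENNReal.ofReal (q * Real.exp (-q * τ)) := by
        simp only [neg_mul]
        exact lintegral_mono_set Ioc_subset_Ioi_self
    _ = ENNReal.ofReal (∫ τ in Ioi (0:ℝ), q * Real.exp (-q * τ)) := by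
        rw [ofReal_integral_eq_lintegral_ofReal (hi.const_mul q)]
        exact ae_of_all _ fun x => by positivity
    _ ≤ 1 := by
        rw [integral_const_mul, integral_exp_mul_Ioi (by linarith)]
        simp [h.ne']

lemma tail_int {ε γ : ℝ} (e0 : 0 < ε) (g : γ < 1 / 10) :
    ∫⁻ k in Ioi (1 / ε), ENNReal.ofReal (k ^ (8 * γ - 2)) =
      ENNReal.ofReal (1 / (1 - 8 * γ) * ε ^ (1 - 8 * γ)) := by
  have hc : 0 < 1 / ε := by positivity
  rw [← ofReal_integral_eq_lintegral_ofReal (integrableOn_Ioi_rpow_of_lt (by linarith) hc),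
    integral_Ioi_rpow_of_lt (by linarith) hc]
  · congr 1
    rw [one_div ε, Real.inv_rpow e0.le, ← Real.rpow_neg e0.le,
      show -(8 * γ - 2 + 1) = 1 - 8 * γ by ring, show 8 * γ - 2 + 1 = -(1 - 8 * γ) by ring, neg_div_neg_eq]
    ring
  · refine (ae_restrict_iff' measurableSet_Ioi).2 (ae_of_all _ fun x hx => ?_)
    have : 0 < x := hc.trans hx
    positivity

lemma wgt_int {ε γ : ℝ} (e0 : 0 < ε) (g : γ < 1 / 10) :
    ∫⁻ k, ENNReal.ofReal (wgt ε γ k) ≤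
      ENNReal.ofReal (2 * ε ^ (1 - 4 * γ) + 2 / (1 - 8 * γ) * ε ^ (1 - 8 * γ)) := by
  have hg : 0 < 1 - 8 * γ := by linarith
  have hu : (univ : Set ℝ) = Icc (-(1 / ε)) (1 / ε) ∪ (Ioi (1 / ε) ∪ Iio (-(1 / ε))) := by
    ext x; simp only [mem_univ, mem_union, mem_Icc, mem_Ioi, mem_Iio, true_iff]
    by_contra! h
    exact absurd (h.1 h.2.2) (not_lt.2 h.2.1)
  have hout : ∀ k, 1 / ε < |k| → wgt ε γ k = |k| ^ (8 * γ - 2) := fun k hk => by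
    rw [wgt, if_neg]
    rw [abs_mul, abs_of_pos e0, not_le]
    rwa [div_lt_iff₀ e0] at hk
  have hc : 0 < 1 / ε := by positivity
  have I1 : ∫⁻ k in Icc (-(1 / ε)) (1 / ε), ENNReal.ofReal (wgt ε γ k) =
      ENNReal.ofReal (2 * ε ^ (1 - 4 * γ)) := by
    rw [setLIntegral_congr_fun (g := fun _ => ENNReal.ofReal (ε ^ (2 - 4 * γ))) measurableSet_Icc]
    · rw [setLIntegral_const, Real.volume_Icc, ← ENNReal.ofReal_mul (by positivity)]
      congr 1
      rw [show (2:ℝ) - 4 * γ = (1 - 4 * γ) + 1 by ring, Real.rpow_add_one e0.ne']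
      field_simp; ring
    · intro k hk
      have : |k| ≤ 1 / ε := abs_le.2 hk
      simp only
      rw [wgt, if_pos]
      rw [abs_mul, abs_of_pos e0]
      rwa [le_div_iff₀ e0] at this
  have I2 : ∫⁻ k in Ioi (1 / ε), ENNReal.ofReal (wgt ε γ k) =
      ENNReal.ofReal (1 / (1 - 8 * γ) * ε ^ (1 - 8 * γ)) := by
    rw [← tail_int e0 g]
    refine setLIntegral_congr_fun measurableSet_Ioi fun k hk => ?_
    have hk' : 1 / ε < |k| := lt_of_lt_of_le hk (le_abs_self k)
    rw [hout k hk', abs_of_pos (hc.trans hk)]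
  have I3 : ∫⁻ k in Iio (-(1 / ε)), ENNReal.ofReal (wgt ε γ k) =
      ENNReal.ofReal (1 / (1 - 8 * γ) * ε ^ (1 - 8 * γ)) := by
    rw [← I2]
    have := (Measure.measurePreserving_neg (volume : Measure ℝ)).setLIntegral_comp_preimage
      (s := Ioi (1 / ε)) measurableSet_Ioi
      (f := fun k => ENNReal.ofReal (wgt ε γ k)) (wgt_meas ε γ).ennreal_ofReal
    rw [← this]
    have hs : (Neg.neg ⁻¹' Ioi (1 / ε) : Set ℝ) = Iio (-(1 / ε)) := by
      ext x; simp only [mem_preimage, mem_Ioi, mem_Iio]; constructor <;> intro h <;> linarith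
    rw [show (fun x : ℝ => -x) ⁻¹' Ioi (1 / ε) = Iio (-(1 / ε)) from hs]
    congr 1; ext k; simp [wgt]
  rw [← setLIntegral_univ, hu]
  refine (lintegral_union_le _ _ _).trans ?_
  refine (add_le_add le_rfl (lintegral_union_le _ _ _)).trans ?_
  rw [I1, I2, I3, ← ENNReal.ofReal_add (by positivity) (by positivity),
    ← ENNReal.ofReal_add (by positivity) (by positivity)]
  exact ENNReal.ofReal_le_ofReal (le_of_eq (by ring))

/-- Averaged time-Hölder term of the `𝒦_γ`-norm: for every `T > 0`, `κ > 0` and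
`γ ∈ (0,1/10)` with `10γ + κ < 1` there is `C > 0` such that for all `ε ∈ (0,1)` and
`|ν| ≤ 1`,
`sup_{0≤R<S≤T} (S−R)^{−2γ} ∫_0^R ∫_ℝ |f(S−R+τ,k) − f(τ,k)|² dk dτ ≤ C ε^{1−10γ−κ}`. -/
theorem stmt_19 (T : ℝ) (hT : 0 < T) (κ γ : ℝ) (hκ : 0 < κ)
    (hγ : γ ∈ Set.Ioo (0 : ℝ) (1 / 10)) (hγκ : 10 * γ + κ < 1) :
    ∃ C > (0 : ℝ), ∀ ε ∈ Set.Ioo (0 : ℝ) 1, ∀ ν : ℝ, |ν| ≤ 1 →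
      (⨆ (R : ℝ) (S : ℝ) (_ : 0 ≤ R) (_ : R < S) (_ : S ≤ T),
          ENNReal.ofReal ((S - R) ^ (-(2 * γ))) *
            ∫⁻ τ in Set.Ioc (0 : ℝ) R, ∫⁻ k : ℝ,
              ENNReal.ofReal ((fker ε ν (S - R + τ) k - fker ε ν τ k) ^ 2)) ≤
        ENNReal.ofReal (C * ε ^ (1 - 10 * γ - κ)) := by
  obtain ⟨g0, g1⟩ := hγ
  have hg : 0 < 1 - 8 * γ := by linarith
  refine ⟨(150 * Real.exp T ^ 2) ^ 2 * (2 + 2 / (1 - 8 * γ)), by positivity, ?_⟩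
  rintro ε ⟨e0, e1⟩ ν hν
  refine iSup_le fun R => iSup_le fun S => iSup_le fun hR => iSup_le fun hRS => iSup_le fun hS => ?_
  have h0 : 0 < S - R := sub_pos.2 hRS
  set h := S - R with hh
  set K := (150 * Real.exp T ^ 2) ^ 2 with hK
  have hK0 : 0 ≤ K := by positivity
  have main : ∫⁻ τ in Set.Ioc (0 : ℝ) R, ∫⁻ k : ℝ,
      ENNReal.ofReal ((fker ε ν (h + τ) k - fker ε ν τ k) ^ 2) ≤
      ENNReal.ofReal (K * h ^ (2 * γ)) * ∫⁻ k, ENNReal.ofReal (wgt ε γ k) := by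
    calc _ ≤ ∫⁻ τ in Set.Ioc (0 : ℝ) R, ∫⁻ k : ℝ, ENNReal.ofReal (K * h ^ (2 * γ)) *
          (ENNReal.ofReal (wgt ε γ k) * ENNReal.ofReal (k ^ 2 * Real.exp (-(k ^ 2 * τ)))) := by
          refine setLIntegral_mono' measurableSet_Ioc fun τ hτ => lintegral_mono fun k => ?_
          rw [← ENNReal.ofReal_mul (wgt_nonneg e0), ← ENNReal.ofReal_mul (by positivity)]
          exact ENNReal.ofReal_le_ofReal
            (bound_all h0 (by linarith) hτ.1 (by linarith [hτ.2]) hν g0 (by linarith) e0 e1)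
      _ = ∫⁻ k : ℝ, ∫⁻ τ in Set.Ioc (0 : ℝ) R, ENNReal.ofReal (K * h ^ (2 * γ)) *
          (ENNReal.ofReal (wgt ε γ k) * ENNReal.ofReal (k ^ 2 * Real.exp (-(k ^ 2 * τ)))) := by
          refine lintegral_lintegral_swap (Measurable.aemeasurable ?_)
          have : Measurable (fun p : ℝ × ℝ => wgt ε γ p.2) := (wgt_meas ε γ).comp measurable_snd
          refine Measurable.const_mul (Measurable.mul this.ennreal_ofReal ?_) _
          fun_prop
      _ ≤ ∫⁻ k : ℝ, ENNReal.ofReal (K * h ^ (2 * γ)) * ENNReal.ofReal (wgt ε γ k) := by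
          refine lintegral_mono fun k => ?_
          simp only
          rw [lintegral_const_mul _ (by fun_prop), lintegral_const_mul _ (by fun_prop)]
          gcongr
          exact mul_le_of_le_one_right' (exp_int (sq_nonneg k))
      _ = _ := lintegral_const_mul _ (wgt_meas ε γ).ennreal_ofReal
  calc _ ≤ ENNReal.ofReal (h ^ (-(2 * γ))) * (ENNReal.ofReal (K * h ^ (2 * γ)) *
        ENNReal.ofReal (2 * ε ^ (1 - 4 * γ) + 2 / (1 - 8 * γ) * ε ^ (1 - 8 * γ))) := by
        gcongr
        exact main.trans (by gcongr; exact wgt_int e0 g1)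
    _ = ENNReal.ofReal (K * (2 * ε ^ (1 - 4 * γ) + 2 / (1 - 8 * γ) * ε ^ (1 - 8 * γ))) := by
        rw [← ENNReal.ofReal_mul (by positivity), ← ENNReal.ofReal_mul (by positivity)]
        congr 1
        have : h ^ (-(2 * γ)) * h ^ (2 * γ) = 1 := by
          rw [← Real.rpow_add h0]; simp
        linear_combination K * (2 * ε ^ (1 - 4 * γ) + 2 / (1 - 8 * γ) * ε ^ (1 - 8 * γ)) * this
    _ ≤ _ := by
        apply ENNReal.ofReal_le_ofReal
        rw [mul_assoc, add_mul]
        have r1 : ε ^ (1 - 4 * γ) ≤ ε ^ (1 - 10 * γ - κ) :=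
          Real.rpow_le_rpow_of_exponent_ge e0 e1.le (by linarith)
        have r2 : ε ^ (1 - 8 * γ) ≤ ε ^ (1 - 10 * γ - κ) :=
          Real.rpow_le_rpow_of_exponent_ge e0 e1.le (by linarith)
        gcongr
end
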